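/- Let 1 ≤ p ≤ n be integers and let Λ₁,…,Λ_p be pairwise distinct positive reals with Λ = diag(Λ₁,…,Λ_p). For a complex p×n matrix W, let λ₁(W),…,λ_p(W) denote the (real, nonnegative) eigenvalues of the Hermitian positive semidefinite matrix WW†. Then for every bounded continuous function f : ℝ → ℂ: ∫ (1/p) Σ_{j=1}^{p} f(λ_j(W)) dμ₂(W) = ∫₀^∞ f(x) S₂(x) dx, where S₂(x) := (1/p) Σ_{j=1}^{p} [ e^{−x/Λ_j} Λ_j^{−n} / ∏_{l≠j} (1 − Λ_l/Λ_j) ] · Σ_{k=1}^{p} x^{n−k} E_{k−1}(−Λ^ĵ)/(n−k)! for x > 0. In particular, S₂ is the marginal eigenvalue density of the complex Wishart correlation matrix and vanishes on (−∞, 0). -/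

import Mathlib

open MeasureTheory Matrix BoundedContinuousFunction

/-- The complex Wishart measure with parameter `Λ = diag(Λ₁,…,Λ_p)`: the probability
measure on complex `p × n` matrices (identified with the pi type `Fin p → Fin n → ℂ`
carrying Lebesgue measure) with density `P₂(W) = (π^p det Λ)^{-n} exp(-tr(W† Λ⁻¹ W))`. -/
noncomputable def wishartMeasureComplex (p n : ℕ) (Λ : Fin p → ℝ) :
    Measure (Fin p → Fin n → ℂ) :=
  volume.withDensity fun W =>
    ENNReal.ofReal (((Real.pi ^ p * ∏ j, Λ j) ^ n)⁻¹ *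
      Real.exp (-((Matrix.of W)ᴴ *
          (Matrix.diagonal fun j => (Λ j : ℂ))⁻¹ * Matrix.of W).trace.re))

/-- The `k`-th elementary symmetric function of `(v i)_{i ∈ s}`. -/
noncomputable def esymm {p : ℕ} (s : Finset (Fin p)) (v : Fin p → ℝ) (k : ℕ) : ℝ :=
  ∑ t ∈ s.powersetCard k, ∏ i ∈ t, v i

/-- The one-point function `S₂` of the complex Wishart correlation matrix ensemble:
`S₂(x) = (1/p) Σ_j [e^{−x/Λ_j} Λ_j^{−n} / ∏_{l≠j}(1−Λ_l/Λ_j)]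
  Σ_{k=1}^p x^{n−k} E_{k−1}(−Λ^ĵ)/(n−k)!`. -/
noncomputable def onePointFunctionComplex (p n : ℕ) (Λ : Fin p → ℝ) (x : ℝ) : ℝ :=
  (p : ℝ)⁻¹ * ∑ j, (Real.exp (-(x / Λ j)) * ((Λ j) ^ n)⁻¹ /
      ∏ l ∈ Finset.univ.erase j, (1 - Λ l / Λ j)) *
    ∑ k ∈ Finset.Icc 1 p, x ^ (n - k) *
      esymm (Finset.univ.erase j) (fun l => -Λ l) (k - 1) / (Nat.factorial (n - k))

section GaussianComplex

open scoped ComplexConjugate ComplexOrder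

lemma cexp_neg_mul_conj_mul (b : ℝ) (y : ℂ) :
    Complex.exp (-(b * (conj y * y))) = (Real.exp (-b * ‖y‖ ^ 2) : ℂ) := by
  rw [Complex.conj_mul']
  push_cast
  ring_nf

lemma integral_cexp_neg_mul_conj_mul {b : ℝ} (hb : 0 < b) :
    ∫ y : ℂ, Complex.exp (-(b * (conj y * y))) = Real.pi / b := by
  simp_rw [cexp_neg_mul_conj_mul, integral_complex_ofReal]
  have h := Complex.integral_exp_neg_mul_rpow (p := 2) (by norm_num) hb
  simp only [Real.rpow_two] at h
  rw [h, show (-2 / 2 : ℝ) = -1 by norm_num, show (2 / 2 + 1 : ℝ) = 1 + 1 by norm_num,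
    Real.Gamma_add_one one_ne_zero, Real.Gamma_one, Real.rpow_neg_one]
  push_cast
  ring

lemma integral_cexp_neg_mul_conj_mul_mul_conj {b : ℝ} (hb : 0 < b) :
    ∫ y : ℂ, Complex.exp (-(b * (conj y * y))) * (y * conj y) = Real.pi / b * (1 / b) := by
  have h := Complex.integral_rpow_mul_exp_neg_mul_rpow (p := 2) (q := 2)
    (by norm_num) (by norm_num) hb
  simp only [Real.rpow_two] at h
  have h' : ∀ y : ℂ, Complex.exp (-(b * (conj y * y))) * (y * conj y)
      = ((‖y‖ ^ 2 * Real.exp (-b * ‖y‖ ^ 2) : ℝ) : ℂ) := by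
    intro y
    rw [cexp_neg_mul_conj_mul, Complex.mul_conj']
    push_cast
    ring
  simp_rw [h', integral_complex_ofReal]
  rw [h, show ((2 + 2) / 2 : ℝ) = 1 + 1 by norm_num, Real.Gamma_add_one one_ne_zero,
    Real.Gamma_one, show (-(2 + 2) / 2 : ℝ) = -(2 : ℝ) by norm_num, Real.rpow_neg hb.le,
    Real.rpow_two]
  push_cast
  field_simp

lemma integral_cexp_neg_mul_conj_mul_mul_self (b : ℝ) :
    ∫ y : ℂ, Complex.exp (-(b * (conj y * y))) * y = 0 := by
  have h := integral_neg_eq_self (fun y : ℂ => Complex.exp (-(b * (conj y * y))) * y) volume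
  simp only [map_neg, neg_mul, mul_neg, neg_neg, integral_neg] at h
  exact self_eq_neg.mp h.symm

lemma integrable_cexp_neg_mul_conj_mul {b : ℝ} (hb : 0 < b) :
    Integrable fun y : ℂ => Complex.exp (-(b * (conj y * y))) := by
  apply Integrable.of_integral_ne_zero
  rw [integral_cexp_neg_mul_conj_mul hb]
  simp [hb.ne', Real.pi_ne_zero]

lemma integrable_cexp_neg_mul_conj_mul_mul_conj {b : ℝ} (hb : 0 < b) :
    Integrable fun y : ℂ => Complex.exp (-(b * (conj y * y))) * (y * conj y) := by
  apply Integrable.of_integral_ne_zero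
  rw [integral_cexp_neg_mul_conj_mul_mul_conj hb]
  simp [hb.ne', Real.pi_ne_zero]

lemma integrable_cexp_neg_mul_conj_mul_mul_self {b : ℝ} (hb : 0 < b) :
    Integrable fun y : ℂ => Complex.exp (-(b * (conj y * y))) * y := by
  refine ((integrable_cexp_neg_mul_conj_mul hb).norm.add
    (integrable_cexp_neg_mul_conj_mul_mul_conj hb).norm).mono' (by fun_prop) (.of_forall fun y => ?_)
  simp only [norm_mul, Pi.add_apply, RCLike.norm_conj]
  nlinarith [norm_nonneg (Complex.exp (-(b * (conj y * y)))), sq_nonneg (‖y‖ - 1 / 2),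
    mul_nonneg (norm_nonneg (Complex.exp (-(b * (conj y * y))))) (sq_nonneg (‖y‖ - 1 / 2))]

lemma integrable_cexp_neg_mul_conj_mul_mul_conj_self {b : ℝ} (hb : 0 < b) :
    Integrable fun y : ℂ => Complex.exp (-(b * (conj y * y))) * conj y := by
  refine (integrable_cexp_neg_mul_conj_mul_mul_self hb).norm.mono' (by fun_prop)
    (.of_forall fun y => ?_)
  simp

/-- The Gaussian weight `exp(-x† A x)` on complex vectors. -/
noncomputable def gaussWeight {ι : Type*} [Fintype ι] (A : Matrix ι ι ℂ) (x : ι → ℂ) : ℂ :=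
  Complex.exp (-(star x ⬝ᵥ A *ᵥ x))

lemma Continuous.gaussWeight {ι X : Type*} [Fintype ι] [TopologicalSpace X]
    {A : X → Matrix ι ι ℂ} {x : X → ι → ℂ} (hA : Continuous A) (hx : Continuous x) :
    Continuous fun t => gaussWeight (A t) (x t) := by
  unfold _root_.gaussWeight
  fun_prop

lemma gaussWeight_diagonal {ι : Type*} [Fintype ι] [DecidableEq ι] (d : ι → ℝ) (x : ι → ℂ) :
    gaussWeight (diagonal fun i => (d i : ℂ)) x
      = ∏ i, Complex.exp (-(d i * (conj (x i) * x i))) := by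
  rw [gaussWeight, ← Complex.exp_sum, Finset.sum_neg_distrib]
  congr 2
  refine Finset.sum_congr rfl fun i _ => ?_
  rw [mulVec_diagonal]
  simp only [Pi.star_apply, RCLike.star_def]
  ring

lemma integrable_gaussWeight_diagonal {ι : Type*} [Fintype ι] [DecidableEq ι] {d : ι → ℝ}
    (hd : ∀ i, 0 < d i) :
    Integrable fun x : ι → ℂ => gaussWeight (diagonal fun i => (d i : ℂ)) x := by
  simp_rw [gaussWeight_diagonal]
  exact Integrable.fintype_prod fun i => integrable_cexp_neg_mul_conj_mul (hd i)

lemma integral_gaussWeight_diagonal {ι : Type*} [Fintype ι] [DecidableEq ι] {d : ι → ℝ}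
    (hd : ∀ i, 0 < d i) :
    ∫ x : ι → ℂ, gaussWeight (diagonal fun i => (d i : ℂ)) x = ∏ i, (Real.pi / d i : ℂ) := by
  simp_rw [gaussWeight_diagonal]
  rw [integral_fintype_prod_volume_eq_prod
    (fun i (y : ℂ) => Complex.exp (-(d i * (conj y * y))))]
  exact Finset.prod_congr rfl fun i _ => integral_cexp_neg_mul_conj_mul (hd i)

lemma gaussWeight_diagonal_mul {ι : Type*} [Fintype ι] [DecidableEq ι] (d : ι → ℝ) (k l : ι)
    (x : ι → ℂ) :
    gaussWeight (diagonal fun i => (d i : ℂ)) x * (x k * conj (x l))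
      = ∏ i, (Complex.exp (-(d i * (conj (x i) * x i))) *
          ((if i = k then x i else 1) * (if i = l then conj (x i) else 1))) := by
  rw [gaussWeight_diagonal, Finset.prod_mul_distrib, Finset.prod_mul_distrib]
  simp

lemma integrable_gaussWeight_diagonal_mul {ι : Type*} [Fintype ι] [DecidableEq ι] {d : ι → ℝ}
    (hd : ∀ i, 0 < d i) (k l : ι) :
    Integrable fun x : ι → ℂ =>
      gaussWeight (diagonal fun i => (d i : ℂ)) x * (x k * conj (x l)) := by
  simp_rw [gaussWeight_diagonal_mul]
  refine Integrable.fintype_prod (f := fun i (y : ℂ) => Complex.exp (-(d i * (conj y * y))) *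
          ((if i = k then y else 1) * (if i = l then conj y else 1))) fun i => ?_
  by_cases h1 : i = k <;> by_cases h2 : i = l <;> simp only [h1, h2, if_true, if_false, mul_one]
  · split_ifs
    · exact integrable_cexp_neg_mul_conj_mul_mul_conj (hd _)
    · simpa using integrable_cexp_neg_mul_conj_mul_mul_self (hd _)
  · simpa [← h1, h2] using integrable_cexp_neg_mul_conj_mul_mul_self (hd _)
  · simpa [← h2, h1] using integrable_cexp_neg_mul_conj_mul_mul_conj_self (hd _)
  · exact integrable_cexp_neg_mul_conj_mul (hd _)

lemma integral_gaussWeight_diagonal_mul {ι : Type*} [Fintype ι] [DecidableEq ι] {d : ι → ℝ}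
    (hd : ∀ i, 0 < d i) (k l : ι) :
    ∫ x : ι → ℂ, gaussWeight (diagonal fun i => (d i : ℂ)) x * (x k * conj (x l))
      = (∏ i, (Real.pi / d i : ℂ)) * (if k = l then (1 / d k : ℂ) else 0) := by
  simp_rw [gaussWeight_diagonal_mul]
  rw [integral_fintype_prod_volume_eq_prod
    (fun i (y : ℂ) => Complex.exp (-(d i * (conj y * y))) *
          ((if i = k then y else 1) * (if i = l then conj y else 1)))]
  by_cases hkl : k = l
  · subst hkl
    have : ∀ i, ∫ y : ℂ, Complex.exp (-(d i * (conj y * y))) *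
        ((if i = k then y else 1) * (if i = k then conj y else 1))
        = (Real.pi / d i : ℂ) * (if i = k then (1 / d k : ℂ) else 1) := by
      intro i
      by_cases h : i = k
      · simp only [h, if_true]
        exact integral_cexp_neg_mul_conj_mul_mul_conj (hd _)
      · simp only [h, if_false, mul_one]
        exact integral_cexp_neg_mul_conj_mul (hd _)
    simp_rw [this]
    rw [Finset.prod_mul_distrib]
    simp
  · simp only [hkl, if_false, mul_zero]
    refine Finset.prod_eq_zero (Finset.mem_univ k) ?_
    simpa [hkl] using integral_cexp_neg_mul_conj_mul_mul_self (d k)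

/-- A unitary change of variables preserves Lebesgue measure. -/
lemma measurePreserving_unitary_mulVec {ι : Type*} [Fintype ι] [DecidableEq ι]
    (U : unitaryGroup ι ℂ) :
    MeasurePreserving (fun x : ι → ℂ => (U : Matrix ι ι ℂ) *ᵥ x) := by
  have hdet : LinearMap.det ((Matrix.toLin' (U : Matrix ι ι ℂ)).restrictScalars ℝ)
      = ‖(U : Matrix ι ι ℂ).det‖ ^ 2 := by
    rw [LinearMap.det_restrictScalars, LinearMap.det_toLin', Algebra.norm_complex_apply,
      Complex.normSq_eq_norm_sq]
  have hU : ‖(U : Matrix ι ι ℂ).det‖ = 1 := by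
    have := (Matrix.det_of_mem_unitary U.2)
    exact CStarRing.norm_of_mem_unitary this
  rw [hU, one_pow] at hdet
  refine ⟨by fun_prop, ?_⟩
  have := Measure.map_linearMap_addHaar_eq_smul_addHaar (volume : Measure (ι → ℂ))
    (f := (Matrix.toLin' (U : Matrix ι ι ℂ)).restrictScalars ℝ) (by rw [hdet]; exact one_ne_zero)
  rw [hdet] at this
  simp only [inv_one, abs_one, ENNReal.ofReal_one, one_smul] at this
  exact this

lemma gaussWeight_unitary {ι : Type*} [Fintype ι] [DecidableEq ι] (U : unitaryGroup ι ℂ)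
    (D : Matrix ι ι ℂ) (x : ι → ℂ) :
    gaussWeight ((U : Matrix ι ι ℂ) * D * star (U : Matrix ι ι ℂ)) ((U : Matrix ι ι ℂ) *ᵥ x)
      = gaussWeight D x := by
  have hU : star (U : Matrix ι ι ℂ) * U = 1 := by simp
  rw [gaussWeight, gaussWeight, star_mulVec, mulVec_mulVec, mul_assoc, mul_assoc, hU, mul_one,
    ← mulVec_mulVec, dotProduct_mulVec, vecMul_vecMul, ← star_eq_conjTranspose, hU, vecMul_one]

lemma gaussWeight_eigenvectorUnitary {ι : Type*} [Fintype ι] [DecidableEq ι] {A : Matrix ι ι ℂ}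
    (hA : A.IsHermitian) (x : ι → ℂ) :
    gaussWeight A ((hA.eigenvectorUnitary : Matrix ι ι ℂ) *ᵥ x)
      = gaussWeight (diagonal fun i => (hA.eigenvalues i : ℂ)) x := by
  have hs := hA.spectral_theorem
  rw [Unitary.conjStarAlgAut_apply] at hs
  exact (congrArg (fun B => gaussWeight B ((hA.eigenvectorUnitary : Matrix ι ι ℂ) *ᵥ x)) hs).trans
    (gaussWeight_unitary _ _ _)

lemma integrable_gaussWeight {ι : Type*} [Fintype ι] [DecidableEq ι] {A : Matrix ι ι ℂ}
    (hA : A.PosDef) : Integrable (fun x => gaussWeight A x) := by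
  have hc : Continuous (fun x => gaussWeight A x) := continuous_const.gaussWeight continuous_id
  have hU := measurePreserving_unitary_mulVec hA.1.eigenvectorUnitary
  refine (hU.integrable_comp hc.aestronglyMeasurable).1 ?_
  simp only [Function.comp_def, gaussWeight_eigenvectorUnitary]
  exact integrable_gaussWeight_diagonal hA.eigenvalues_pos

lemma integral_gaussWeight {ι : Type*} [Fintype ι] [DecidableEq ι] {A : Matrix ι ι ℂ}
    (hA : A.PosDef) : ∫ x, gaussWeight A x = Real.pi ^ Fintype.card ι / A.det := by
  have hc : Continuous (fun x => gaussWeight A x) := continuous_const.gaussWeight continuous_id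
  have hU := measurePreserving_unitary_mulVec hA.1.eigenvectorUnitary
  rw [← hU.map_eq, integral_map hU.measurable.aemeasurable hc.aestronglyMeasurable]
  simp only [gaussWeight_eigenvectorUnitary]
  rw [integral_gaussWeight_diagonal hA.eigenvalues_pos, Finset.prod_div_distrib,
    Finset.prod_const, hA.1.det_eq_prod_eigenvalues]
  rfl

lemma inv_apply_eq_sum_eigenvectorUnitary {ι : Type*} [Fintype ι] [DecidableEq ι]
    {A : Matrix ι ι ℂ} (hA : A.PosDef) (i j : ι) :
    A⁻¹ i j = ∑ k, (hA.1.eigenvectorUnitary : Matrix ι ι ℂ) i k *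
      conj ((hA.1.eigenvectorUnitary : Matrix ι ι ℂ) j k) * (1 / hA.1.eigenvalues k : ℂ) := by
  set U := (hA.1.eigenvectorUnitary : Matrix ι ι ℂ) with hUdef
  have hs := hA.1.spectral_theorem
  rw [Unitary.conjStarAlgAut_apply] at hs
  have h1 : star U * U = 1 := by simp [U]
  have h2 : U * star U = 1 := by simp [U]
  have hinv : A⁻¹ = U * (diagonal fun k => (1 / hA.1.eigenvalues k : ℂ)) * star U := by
    refine inv_eq_right_inv ?_
    calc A * (U * (diagonal fun k => (1 / hA.1.eigenvalues k : ℂ)) * star U)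
        = U * diagonal (RCLike.ofReal ∘ hA.1.eigenvalues) * star U *
          (U * (diagonal fun k => (1 / hA.1.eigenvalues k : ℂ)) * star U) :=
          congrArg (· * (U * (diagonal fun k => (1 / hA.1.eigenvalues k : ℂ)) * star U)) hs
      _ = U * diagonal (RCLike.ofReal ∘ hA.1.eigenvalues) * (star U * U) *
          (diagonal fun k => (1 / hA.1.eigenvalues k : ℂ)) * star U := by
          simp only [Matrix.mul_assoc]
      _ = 1 := by
          rw [h1, Matrix.mul_one, Matrix.mul_assoc U, diagonal_mul_diagonal]
          have : (fun k => (RCLike.ofReal ∘ hA.1.eigenvalues) k *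
              (1 / hA.1.eigenvalues k : ℂ)) = fun _ => 1 := by
            funext k
            have : (hA.1.eigenvalues k : ℂ) ≠ 0 := by exact_mod_cast (hA.eigenvalues_pos k).ne'
            simp [this]
          rw [this, diagonal_one, Matrix.mul_one, h2]
  rw [hinv, Matrix.mul_apply]
  refine Finset.sum_congr rfl fun k _ => ?_
  rw [mul_diagonal, Matrix.star_apply]
  exact mul_right_comm _ _ _

lemma gaussWeight_mul_eigenvectorUnitary {ι : Type*} [Fintype ι] [DecidableEq ι]
    {A : Matrix ι ι ℂ} (hA : A.IsHermitian) (i j : ι) (x : ι → ℂ) :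
    gaussWeight A ((hA.eigenvectorUnitary : Matrix ι ι ℂ) *ᵥ x) *
        (((hA.eigenvectorUnitary : Matrix ι ι ℂ) *ᵥ x) i *
          conj (((hA.eigenvectorUnitary : Matrix ι ι ℂ) *ᵥ x) j))
      = ∑ k, ∑ l, (hA.eigenvectorUnitary : Matrix ι ι ℂ) i k *
          conj ((hA.eigenvectorUnitary : Matrix ι ι ℂ) j l) *
          (gaussWeight (diagonal fun i => (hA.eigenvalues i : ℂ)) x * (x k * conj (x l))) := by
  rw [gaussWeight_eigenvectorUnitary]
  simp only [mulVec, dotProduct, map_sum, map_mul]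
  rw [Finset.sum_mul_sum]
  simp only [Finset.mul_sum]
  refine Finset.sum_congr rfl fun k _ => Finset.sum_congr rfl fun l _ => ?_
  ring

lemma integrable_gaussWeight_mul {ι : Type*} [Fintype ι] [DecidableEq ι]
    {A : Matrix ι ι ℂ} (hA : A.PosDef) (i j : ι) :
    Integrable (fun x => gaussWeight A x * (x i * conj (x j))) := by
  have hc : Continuous (fun x => gaussWeight A x * (x i * conj (x j))) :=
    (continuous_const.gaussWeight continuous_id).mul (by fun_prop)
  have hU := measurePreserving_unitary_mulVec hA.1.eigenvectorUnitary
  refine (hU.integrable_comp hc.aestronglyMeasurable).1 ?_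
  simp only [Function.comp_def, gaussWeight_mul_eigenvectorUnitary]
  exact integrable_finsetSum _ fun k _ => integrable_finsetSum _ fun l _ =>
    (integrable_gaussWeight_diagonal_mul hA.eigenvalues_pos k l).const_mul _

lemma integral_gaussWeight_mul {ι : Type*} [Fintype ι] [DecidableEq ι]
    {A : Matrix ι ι ℂ} (hA : A.PosDef) (i j : ι) :
    ∫ x, gaussWeight A x * (x i * conj (x j))
        = Real.pi ^ Fintype.card ι / A.det * A⁻¹ i j := by
  have hc : Continuous (fun x => gaussWeight A x * (x i * conj (x j))) :=
    (continuous_const.gaussWeight continuous_id).mul (by fun_prop)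
  have hU := measurePreserving_unitary_mulVec hA.1.eigenvectorUnitary
  rw [← hU.map_eq, integral_map hU.measurable.aemeasurable hc.aestronglyMeasurable]
  simp only [gaussWeight_mul_eigenvectorUnitary]
  have hI := fun k l => integrable_gaussWeight_diagonal_mul hA.eigenvalues_pos k l
  rw [integral_finsetSum _ fun k _ => integrable_finsetSum _ fun l _ => (hI k l).const_mul _]
  simp_rw [integral_finsetSum _ fun l _ => (hI _ l).const_mul _, integral_const_mul,
    integral_gaussWeight_diagonal_mul hA.eigenvalues_pos]
  have hd : ∏ k, (Real.pi / hA.1.eigenvalues k : ℂ) = Real.pi ^ Fintype.card ι / A.det := by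
    rw [Finset.prod_div_distrib, Finset.prod_const, hA.1.det_eq_prod_eigenvalues]
    rfl
  rw [hd, inv_apply_eq_sum_eigenvectorUnitary hA, Finset.mul_sum]
  refine Finset.sum_congr rfl fun k _ => ?_
  simp only [mul_ite, mul_zero, Finset.sum_ite_eq, Finset.mem_univ, if_true]
  ring

end GaussianComplex

section GramMinors

open scoped ComplexConjugate ComplexOrder

lemma prod_mul_prod_comp_eq_prod_fiberwise {κ I E : Type*} [Fintype κ] [Fintype I] [DecidableEq κ]
    (φ : I → κ) (ρ : E → ℂ) (g : I → E → ℂ) (V : κ → E) :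
    (∏ a, ρ (V a)) * ∏ i, g i (V (φ i))
      = ∏ a, (ρ (V a) * ∏ i with φ i = a, g i (V a)) := by
  rw [Finset.prod_mul_distrib, ← Finset.prod_fiberwise (s := Finset.univ) (g := φ)]
  congr 1
  refine Finset.prod_congr rfl fun a _ => Finset.prod_congr rfl fun i hi => ?_
  rw [(Finset.mem_filter.mp hi).2]

lemma filter_fiber_of_injective {κ I : Type*} [Fintype I] [DecidableEq κ] {φ : I → κ}
    (hφ : Function.Injective φ) (a : κ) :
    (∃ i, Finset.univ.filter (fun j => φ j = a) = {i}) ∨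
      Finset.univ.filter (fun j => φ j = a) = ∅ := by
  by_cases h : ∃ i, φ i = a
  · obtain ⟨i, rfl⟩ := h
    left
    refine ⟨i, ?_⟩
    ext j
    simp [hφ.eq_iff]
  · right
    ext j
    simpa using fun hj => h ⟨j, hj⟩

lemma integrable_prod_mul_prod_comp {κ I E : Type*} [Fintype κ] [Fintype I]
    [MeasureSpace E] [SigmaFinite (volume : Measure E)] {φ : I → κ} (hφ : Function.Injective φ)
    {ρ : E → ℂ} {g : I → E → ℂ} (hρ : Integrable ρ) (hg : ∀ i, Integrable fun x => ρ x * g i x) :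
    Integrable fun V : κ → E => (∏ a, ρ (V a)) * ∏ i, g i (V (φ i)) := by
  classical
  simp_rw [prod_mul_prod_comp_eq_prod_fiberwise]
  refine Integrable.fintype_prod (f := fun a x => ρ x * ∏ i with φ i = a, g i x) fun a => ?_
  rcases filter_fiber_of_injective hφ a with ⟨i, h⟩ | h
  · simpa [h] using hg i
  · simpa [h] using hρ

lemma integral_prod_mul_prod_comp {κ I E : Type*} [Fintype κ] [Fintype I]
    [MeasureSpace E] [SigmaFinite (volume : Measure E)] {φ : I → κ} (hφ : Function.Injective φ)
    {ρ : E → ℂ} {g : I → E → ℂ} {m : I → ℂ} (hg : ∀ i, ∫ x, ρ x * g i x = (∫ x, ρ x) * m i) :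
    ∫ V : κ → E, (∏ a, ρ (V a)) * ∏ i, g i (V (φ i))
      = (∫ x, ρ x) ^ Fintype.card κ * ∏ i, m i := by
  classical
  simp_rw [prod_mul_prod_comp_eq_prod_fiberwise]
  rw [integral_fintype_prod_volume_eq_prod (fun a x => ρ x * ∏ i with φ i = a, g i x)]
  have : ∀ a, ∫ x, (ρ x * ∏ i with φ i = a, g i x) = (∫ x, ρ x) * ∏ i with φ i = a, m i := by
    intro a
    rcases filter_fiber_of_injective hφ a with ⟨i, h⟩ | h
    · simpa [h] using hg i
    · simp [h]
  simp_rw [this]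
  rw [Finset.prod_mul_distrib, Finset.prod_const, Finset.card_univ]
  exact congrArg _ (Finset.prod_fiberwise Finset.univ φ m)

/-- The Gram matrix `∑ₐ vₐ vₐ†` of a family of complex vectors. -/
noncomputable def outerGram {κ ι : Type*} [Fintype κ] (V : κ → ι → ℂ) : Matrix ι ι ℂ :=
  of fun i j => ∑ a, V a i * conj (V a j)

/-- The principal minor of `A` with rows and columns in `I`. -/
def principalMinor {ι : Type*} [DecidableEq ι] (I : Finset ι) (A : Matrix ι ι ℂ) : ℂ :=
  (A.submatrix (Subtype.val : I → ι) (Subtype.val : I → ι)).det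

lemma principalMinor_eq_sum {ι : Type*} [DecidableEq ι] (I : Finset ι) (A : Matrix ι ι ℂ) :
    principalMinor I A = ∑ σ : Equiv.Perm I, ((Equiv.Perm.sign σ : ℤ) : ℂ) * ∏ i : I, A i (σ i) := by
  rw [principalMinor, ← det_transpose, det_apply']
  rfl

lemma principalMinor_outerGram {κ ι : Type*} [Fintype κ] [DecidableEq ι]
    (I : Finset ι) (V : κ → ι → ℂ) :
    principalMinor I (outerGram V) = ∑ φ : I ↪ κ, ∑ σ : Equiv.Perm I,
      ((Equiv.Perm.sign σ : ℤ) : ℂ) * ∏ i : I, (V (φ i) i * conj (V (φ i) (σ i))) := by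
  classical
  have h1 : principalMinor I (outerGram V) = ∑ φ : I → κ, det (of fun i j : I =>
      V (φ i) i * conj (V (φ i) j)) := by
    have := (detRowAlternating : (I → ℂ) [⋀^I]→ₗ[ℂ] ℂ).toMultilinearMap.map_sum
      (fun (i : I) (a : κ) => fun j : I => V a i * conj (V a j))
    refine Eq.trans ?_ this
    change det _ = det _
    congr 1
    ext i j
    simp [outerGram]
  have h2 : ∀ φ : I → κ, ¬ Function.Injective φ →
      det (of fun i j : I => V (φ i) i * conj (V (φ i) j)) = 0 := by
    intro φ hφ
    rw [Function.Injective] at hφ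
    push Not at hφ
    obtain ⟨i, j, hij, hne⟩ := hφ
    refine (det_mul_column (fun i : I => V (φ i) i) (of fun i j : I => conj (V (φ i) j))).trans ?_
    rw [det_zero_of_row_eq hne (by ext k; simp [hij]), mul_zero]
  rw [h1, ← Finset.sum_subset (Finset.subset_univ (Finset.univ.filter
    (Function.Injective : (I → κ) → Prop))) (fun φ _ h => h2 φ (by simpa using h))]
  rw [Finset.sum_subtype (p := (Function.Injective : (I → κ) → Prop)) _ (by simp),
    ← (Equiv.subtypeInjectiveEquivEmbedding I κ).symm.sum_comp]
  refine Finset.sum_congr rfl fun φ _ => ?_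
  rw [← det_transpose, det_apply']
  rfl

lemma prod_gaussWeight_mul_principalMinor_outerGram {κ ι : Type*} [Fintype κ] [Fintype ι]
    [DecidableEq ι] (A : Matrix ι ι ℂ) (I : Finset ι) (V : κ → ι → ℂ) :
    (∏ a, gaussWeight A (V a)) * principalMinor I (outerGram V)
      = ∑ φ : I ↪ κ, ∑ σ : Equiv.Perm I, ((Equiv.Perm.sign σ : ℤ) : ℂ) *
          ((∏ a, gaussWeight A (V a)) * ∏ i : I, (V (φ i) i * conj (V (φ i) (σ i)))) := by
  rw [principalMinor_outerGram, Finset.mul_sum]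
  refine Finset.sum_congr rfl fun φ _ => ?_
  rw [Finset.mul_sum]
  exact Finset.sum_congr rfl fun σ _ => mul_left_comm _ _ _

lemma integrable_prod_gaussWeight_mul_prod {κ ι : Type*} [Fintype κ]
    [Fintype ι] [DecidableEq ι] {A : Matrix ι ι ℂ} (hA : A.PosDef) (I : Finset ι)
    (φ : I ↪ κ) (σ : Equiv.Perm I) : Integrable fun V : κ → ι → ℂ =>
      (∏ a, gaussWeight A (V a)) * ∏ i : I, (V (φ i) i * conj (V (φ i) (σ i))) := by
  have h := integrable_prod_mul_prod_comp (E := ι → ℂ) (φ := φ) (ρ := gaussWeight A)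
    (g := fun (i : I) x => x i * conj (x (σ i))) φ.injective (integrable_gaussWeight hA)
    (fun i => integrable_gaussWeight_mul hA _ _)
  exact h

lemma integral_prod_gaussWeight_mul_prod {κ ι : Type*} [Fintype κ]
    [Fintype ι] [DecidableEq ι] {A : Matrix ι ι ℂ} (hA : A.PosDef) (I : Finset ι)
    (φ : I ↪ κ) (σ : Equiv.Perm I) : ∫ V : κ → ι → ℂ,
      (∏ a, gaussWeight A (V a)) * ∏ i : I, (V (φ i) i * conj (V (φ i) (σ i)))
      = (Real.pi ^ Fintype.card ι / A.det) ^ Fintype.card κ * ∏ i : I, A⁻¹ i (σ i) := by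
  have h := integral_prod_mul_prod_comp (E := ι → ℂ) (φ := φ) (ρ := gaussWeight A)
    (g := fun (i : I) x => x i * conj (x (σ i))) (m := fun i : I => A⁻¹ i (σ i)) φ.injective
    (fun i => by rw [integral_gaussWeight_mul hA, integral_gaussWeight hA])
  rw [integral_gaussWeight hA] at h
  exact h

lemma integrable_prod_gaussWeight_mul_principalMinor_outerGram (κ : Type*) [Fintype κ] {ι : Type*}
    [Fintype ι] [DecidableEq ι] {A : Matrix ι ι ℂ} (hA : A.PosDef) (I : Finset ι) :
    Integrable fun V : κ → ι → ℂ =>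
      (∏ a, gaussWeight A (V a)) * principalMinor I (outerGram V) := by
  simp only [prod_gaussWeight_mul_principalMinor_outerGram]
  exact integrable_finsetSum _ fun φ _ => integrable_finsetSum _ fun σ _ =>
    (integrable_prod_gaussWeight_mul_prod hA I φ σ).const_mul _

lemma integral_prod_gaussWeight_mul_principalMinor_outerGram (κ : Type*) [Fintype κ] {ι : Type*}
    [Fintype ι] [DecidableEq ι] {A : Matrix ι ι ℂ} (hA : A.PosDef) (I : Finset ι) :
    ∫ V : κ → ι → ℂ, (∏ a, gaussWeight A (V a)) * principalMinor I (outerGram V)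
      = (Real.pi ^ Fintype.card ι / A.det) ^ Fintype.card κ *
        ((Fintype.card κ).descFactorial I.card * principalMinor I A⁻¹) := by
  have hI := integrable_prod_gaussWeight_mul_prod (κ := κ) hA I
  simp only [prod_gaussWeight_mul_principalMinor_outerGram]
  rw [integral_finsetSum _ fun φ _ => integrable_finsetSum _ fun σ _ => (hI φ σ).const_mul _]
  simp_rw [integral_finsetSum _ fun σ _ => (hI _ σ).const_mul _, integral_const_mul,
    integral_prod_gaussWeight_mul_prod hA]
  rw [Finset.sum_const, Finset.card_univ, Fintype.card_embedding_eq, Fintype.card_coe,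
    principalMinor_eq_sum, nsmul_eq_mul, Finset.mul_sum, Finset.mul_sum, Finset.mul_sum]
  refine Finset.sum_congr rfl fun σ _ => ?_
  ring

end GramMinors

section RankOne

open scoped ComplexConjugate ComplexOrder

lemma det_diagonal_add_vecMulVec {ι : Type*} [Fintype ι] [DecidableEq ι] {d : ι → ℂ}
    (hd : ∀ i, d i ≠ 0) (u v : ι → ℂ) :
    det (diagonal d + vecMulVec u v) = (∏ i, d i) * (1 + ∑ i, v i * u i / d i) := by
  have h : diagonal d + vecMulVec u v = diagonal d *
      (1 + replicateCol Unit (fun i => u i / d i) * replicateRow Unit v) := by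
    rw [Matrix.mul_add, Matrix.mul_one]
    congr 1
    ext i j
    rw [diagonal_mul, Matrix.mul_apply]
    simp [vecMulVec_apply]
    field_simp [hd i]
  rw [h, det_mul, det_diagonal, det_one_add_replicateCol_mul_replicateRow]
  simp only [dotProduct, mul_div_assoc]

lemma gaussWeight_add {ι : Type*} [Fintype ι] (A B : Matrix ι ι ℂ) (x : ι → ℂ) :
    gaussWeight (A + B) x = gaussWeight A x * gaussWeight B x := by
  rw [gaussWeight, gaussWeight, gaussWeight, ← Complex.exp_add, add_mulVec, dotProduct_add, neg_add]

lemma outerGram_eq_mul {κ ι : Type*} [Fintype κ] (V : κ → ι → ℂ) :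
    outerGram V = (of V)ᵀ * (of V)ᵀᴴ := by
  ext i j
  simp [outerGram, Matrix.mul_apply]

lemma posSemidef_outerGram {κ ι : Type*} [Fintype κ] [Fintype ι] (V : κ → ι → ℂ) :
    (outerGram V).PosSemidef := by
  rw [outerGram_eq_mul]
  exact posSemidef_self_mul_conjTranspose _

lemma star_dotProduct_outerGram_mulVec {κ ι : Type*} [Fintype κ] [Fintype ι] (V : κ → ι → ℂ)
    (z : ι → ℂ) :
    star z ⬝ᵥ outerGram V *ᵥ z
      = ∑ a, star (V a) ⬝ᵥ vecMulVec z (star z) *ᵥ (V a) := by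
  simp only [dotProduct, mulVec, outerGram, of_apply, vecMulVec_apply, Pi.star_apply,
    RCLike.star_def, Finset.mul_sum, Finset.sum_mul]
  rw [Finset.sum_comm]
  simp_rw [Finset.sum_comm (γ := κ)]
  refine Finset.sum_congr rfl fun i _ => ?_
  refine Finset.sum_congr rfl fun j _ => ?_
  refine Finset.sum_congr rfl fun a _ => ?_
  ring

lemma prod_gaussWeight_vecMulVec {κ ι : Type*} [Fintype κ] [Fintype ι] (V : κ → ι → ℂ)
    (z : ι → ℂ) (w : ℂ) :
    ∏ a, gaussWeight (w • vecMulVec z (star z)) (V a) = gaussWeight (w • outerGram V) z := by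
  simp only [gaussWeight, ← Complex.exp_sum, smul_mulVec, dotProduct_smul,
    star_dotProduct_outerGram_mulVec, Finset.sum_neg_distrib, Finset.smul_sum]

/-- The matrix `Λ⁻¹ + w z z†`. -/
noncomputable def tiltedPrecision {ι : Type*} [DecidableEq ι] (Λ : ι → ℝ) (w : ℝ) (z : ι → ℂ) :
    Matrix ι ι ℂ :=
  diagonal (fun i => (((Λ i)⁻¹ : ℝ) : ℂ)) + (w : ℂ) • vecMulVec z (star z)

lemma posDef_diagonal_inv {ι : Type*} [Fintype ι] [DecidableEq ι] {Λ : ι → ℝ} (hΛ : ∀ i, 0 < Λ i) :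
    (diagonal (fun i => (((Λ i)⁻¹ : ℝ) : ℂ))).PosDef :=
  posDef_diagonal_iff.2 fun i => by exact_mod_cast inv_pos.2 (hΛ i)

lemma posSemidef_ofReal_smul {ι : Type*} {A : Matrix ι ι ℂ} (hA : A.PosSemidef) {w : ℝ}
    (hw : 0 ≤ w) : ((w : ℂ) • A).PosSemidef :=
  hA.smul (by exact_mod_cast hw)

lemma posDef_tiltedPrecision {ι : Type*} [Fintype ι] [DecidableEq ι] {Λ : ι → ℝ}
    (hΛ : ∀ i, 0 < Λ i) {w : ℝ} (hw : 0 ≤ w) (z : ι → ℂ) :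
    (tiltedPrecision Λ w z).PosDef :=
  (posDef_diagonal_inv hΛ).add_posSemidef (posSemidef_ofReal_smul
    (posSemidef_vecMulVec_self_star z) hw)

/-- The scalar `(1 + w ∑ᵢ Λᵢ |zᵢ|²)⁻¹`. -/
noncomputable def tiltFactor {ι : Type*} [Fintype ι] (Λ : ι → ℝ) (w : ℝ) (z : ι → ℂ) : ℝ :=
  (1 + w * ∑ i, Λ i * ‖z i‖ ^ 2)⁻¹

lemma one_le_tilt {ι : Type*} [Fintype ι] {Λ : ι → ℝ} (hΛ : ∀ i, 0 < Λ i) {w : ℝ}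
    (hw : 0 ≤ w) (z : ι → ℂ) : 1 ≤ 1 + w * ∑ i, Λ i * ‖z i‖ ^ 2 :=
  le_add_of_nonneg_right (mul_nonneg hw (Finset.sum_nonneg fun i _ =>
    mul_nonneg (hΛ i).le (sq_nonneg _)))

lemma det_tiltedPrecision {ι : Type*} [Fintype ι] [DecidableEq ι] {Λ : ι → ℝ}
    (hΛ : ∀ i, 0 < Λ i) (w : ℝ) (z : ι → ℂ) :
    (tiltedPrecision Λ w z).det
      = ((∏ i, Λ i)⁻¹ : ℝ) * ((1 + w * ∑ i, Λ i * ‖z i‖ ^ 2 : ℝ) : ℂ) := by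
  rw [tiltedPrecision, ← smul_vecMulVec, det_diagonal_add_vecMulVec]
  · push_cast
    rw [Finset.prod_inv_distrib, Finset.mul_sum]
    congr 2
    refine Finset.sum_congr rfl fun i _ => ?_
    have : (Λ i : ℂ) ≠ 0 := by exact_mod_cast (hΛ i).ne'
    simp only [Pi.star_apply, RCLike.star_def, Pi.smul_apply, smul_eq_mul]
    rw [← Complex.mul_conj']
    field_simp
  · intro i
    exact_mod_cast (inv_pos.2 (hΛ i)).ne'

lemma inv_tiltedPrecision {ι : Type*} [Fintype ι] [DecidableEq ι] {Λ : ι → ℝ}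
    (hΛ : ∀ i, 0 < Λ i) {w : ℝ} (hw : 0 ≤ w) (z : ι → ℂ) :
    (tiltedPrecision Λ w z)⁻¹ = diagonal (fun i => (Λ i : ℂ))
      + vecMulVec (fun i => (-(w * tiltFactor Λ w z) * Λ i : ℂ) * z i)
          (fun i => (Λ i : ℂ) * conj (z i)) := by
  have hΛ0 : ∀ i, (Λ i : ℂ) ≠ 0 := fun i => by exact_mod_cast (hΛ i).ne'
  refine inv_eq_right_inv ?_
  have hT : (1 + w * ∑ i, (Λ i : ℂ) * (‖z i‖ : ℂ) ^ 2) * (tiltFactor Λ w z : ℂ) = 1 := by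
    have := mul_inv_cancel₀ (zero_lt_one.trans_le (one_le_tilt hΛ hw z)).ne'
    rw [tiltFactor]
    exact_mod_cast this
  have hv : vecMulVec z (star z) * vecMulVec (fun i => (-(w * tiltFactor Λ w z) * Λ i : ℂ) * z i)
          (fun i => (Λ i : ℂ) * conj (z i))
      = (-(w * tiltFactor Λ w z) * ∑ i, (Λ i : ℂ) * (‖z i‖ : ℂ) ^ 2 : ℂ) •
        vecMulVec z (fun i => (Λ i : ℂ) * conj (z i)) := by
    ext i j
    simp only [Matrix.mul_apply, vecMulVec_apply, Matrix.smul_apply, smul_eq_mul, Pi.star_apply,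
      RCLike.star_def, Finset.mul_sum, Finset.sum_mul]
    refine Finset.sum_congr rfl fun k _ => ?_
    rw [← Complex.mul_conj']
    ring
  rw [tiltedPrecision, Matrix.add_mul, Matrix.mul_add, Matrix.mul_add, smul_mul_assoc,
    smul_mul_assoc, hv, diagonal_mul_diagonal]
  ext i j
  simp only [Matrix.add_apply, Matrix.smul_apply, smul_eq_mul, diagonal_mul, mul_diagonal, vecMulVec_apply,
    Pi.star_apply, RCLike.star_def]
  have h1 : (diagonal fun i => (((Λ i)⁻¹ : ℝ) : ℂ) * (Λ i : ℂ)) = 1 := by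
    rw [← diagonal_one]
    congr 1
    funext i
    push_cast
    exact inv_mul_cancel₀ (hΛ0 i)
  rw [h1]
  push_cast
  have h2 : ((Λ i : ℂ)⁻¹) * (-(w * tiltFactor Λ w z) * Λ i * z i * (Λ j * conj (z j)))
      = -(w * tiltFactor Λ w z) * z i * (Λ j * conj (z j)) := by
    field_simp [hΛ0 i]
  rw [h2]
  linear_combination (-(w : ℂ) * z i * conj (z j) * Λ j) * hT

lemma principalMinor_inv_tiltedPrecision {ι : Type*} [Fintype ι] [DecidableEq ι] {Λ : ι → ℝ}
    (hΛ : ∀ i, 0 < Λ i) {w : ℝ} (hw : 0 ≤ w) (z : ι → ℂ) (I : Finset ι) :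
    principalMinor I (tiltedPrecision Λ w z)⁻¹
      = (((∏ i ∈ I, Λ i) * (1 - w * tiltFactor Λ w z * ∑ i ∈ I, Λ i * ‖z i‖ ^ 2) : ℝ) : ℂ) := by
  rw [inv_tiltedPrecision hΛ hw, principalMinor]
  have h : (diagonal (fun i => (Λ i : ℂ))
      + vecMulVec (fun i => (-(w * tiltFactor Λ w z) * Λ i : ℂ) * z i)
          (fun i => (Λ i : ℂ) * conj (z i))).submatrix (Subtype.val : I → ι) Subtype.val
      = diagonal (fun i : I => (Λ i : ℂ))
      + vecMulVec (fun i : I => (-(w * tiltFactor Λ w z) * Λ i : ℂ) * z i)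
          (fun i : I => (Λ i : ℂ) * conj (z i)) := by
    ext i j
    simp only [submatrix_apply, Matrix.add_apply, vecMulVec_apply, diagonal_apply, Subtype.ext_iff]
  rw [h, det_diagonal_add_vecMulVec]
  · rw [Finset.prod_coe_sort I (fun i => (Λ i : ℂ)), Finset.sum_coe_sort I
      (fun i => (Λ i : ℂ) * conj (z i) * ((-(w * tiltFactor Λ w z) * Λ i : ℂ) * z i) / Λ i)]
    push_cast
    rw [sub_eq_add_neg, Finset.mul_sum, ← Finset.sum_neg_distrib]
    congr 2
    refine Finset.sum_congr rfl fun i _ => ?_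
    have : (Λ i : ℂ) ≠ 0 := by exact_mod_cast (hΛ i).ne'
    rw [← Complex.mul_conj']
    field_simp
  · intro i
    exact_mod_cast (hΛ i).ne'

end RankOne

section Resolvent

open scoped ComplexConjugate ComplexOrder

lemma norm_gaussWeight_le_one {ι : Type*} [Fintype ι] {A : Matrix ι ι ℂ} (hA : A.PosSemidef)
    (x : ι → ℂ) : ‖gaussWeight A x‖ ≤ 1 := by
  rw [gaussWeight, Complex.norm_exp, Real.exp_le_one_iff, Complex.neg_re, neg_nonpos]
  exact (Complex.le_def.1 (hA.dotProduct_mulVec_nonneg x)).1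

lemma continuous_outerGram {κ ι : Type*} [Fintype κ] :
    Continuous (outerGram : (κ → ι → ℂ) → Matrix ι ι ℂ) := by
  unfold outerGram
  refine continuous_matrix fun i j => ?_
  simp only [of_apply]
  fun_prop

lemma posDef_one_add_smul_outerGram {κ ι : Type*} [Fintype κ] [Fintype ι] [DecidableEq ι]
    (V : κ → ι → ℂ) {w : ℝ} (hw : 0 ≤ w) : (1 + (w : ℂ) • outerGram V).PosDef :=
  PosDef.one.add_posSemidef (posSemidef_ofReal_smul (posSemidef_outerGram V) hw)

lemma integrable_prod_gaussWeight_mul_principalMinor_mul_gaussWeight {κ ι : Type*} [Fintype κ]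
    [Fintype ι] [DecidableEq ι] {A : Matrix ι ι ℂ} (hA : A.PosDef) {w : ℝ} (hw : 0 ≤ w)
    (I : Finset ι) :
    Integrable (fun q : (κ → ι → ℂ) × (ι → ℂ) =>
      (∏ a, gaussWeight A (q.1 a)) * principalMinor I (outerGram q.1) *
        gaussWeight (1 + (w : ℂ) • outerGram q.1) q.2) (volume.prod volume) := by
  have h := (integrable_prod_gaussWeight_mul_principalMinor_outerGram κ hA I).mul_prod
    (integrable_gaussWeight (PosDef.one (n := ι) (R := ℂ)))
  have hG : Continuous fun q : (κ → ι → ℂ) × (ι → ℂ) => outerGram q.1 :=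
    continuous_outerGram.comp continuous_fst
  have hc : Continuous fun q : (κ → ι → ℂ) × (ι → ℂ) =>
      gaussWeight ((w : ℂ) • outerGram q.1) q.2 :=
    (hG.const_smul (w : ℂ)).gaussWeight continuous_snd
  refine (h.mul_bdd (c := 1) hc.aestronglyMeasurable (.of_forall fun q =>
    norm_gaussWeight_le_one (posSemidef_ofReal_smul (posSemidef_outerGram q.1) hw) q.2)).congr
    (.of_forall fun q => ?_)
  simp only [gaussWeight_add]
  ring

lemma integral_principalMinor_div_det_eq_integral_tilt {κ ι : Type*} [Fintype κ]
    [Fintype ι] [DecidableEq ι] {Λ : ι → ℝ} (hΛ : ∀ i, 0 < Λ i) {w : ℝ} (hw : 0 ≤ w)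
    (I : Finset ι) :
    Real.pi ^ Fintype.card ι * ∫ V : κ → ι → ℂ,
        (∏ a, gaussWeight (diagonal (fun i => (((Λ i)⁻¹ : ℝ) : ℂ))) (V a)) *
          principalMinor I (outerGram V) / (1 + (w : ℂ) • outerGram V).det
      = (Real.pi ^ Fintype.card ι * ∏ i, Λ i : ℝ) ^ Fintype.card κ *
        ((Fintype.card κ).descFactorial I.card * (∏ i ∈ I, Λ i : ℝ)) *
        ∫ z : ι → ℂ, gaussWeight 1 z * ((tiltFactor Λ w z ^ Fintype.card κ *
          (1 - w * tiltFactor Λ w z * ∑ i ∈ I, Λ i * ‖z i‖ ^ 2) : ℝ) : ℂ) := by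
  have hD := posDef_diagonal_inv hΛ
  have h := integral_integral_swap (f := fun (V : κ → ι → ℂ) (z : ι → ℂ) =>
      (∏ a, gaussWeight (diagonal (fun i => (((Λ i)⁻¹ : ℝ) : ℂ))) (V a)) *
        principalMinor I (outerGram V) * gaussWeight (1 + (w : ℂ) • outerGram V) z)
    (integrable_prod_gaussWeight_mul_principalMinor_mul_gaussWeight hD hw I)
  rw [← integral_const_mul, ← integral_const_mul]
  convert h using 1
  · refine integral_congr_ae (.of_forall fun V => ?_)
    simp only
    rw [integral_const_mul, integral_gaussWeight (posDef_one_add_smul_outerGram V hw)]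
    ring
  · refine integral_congr_ae (.of_forall fun z => ?_)
    simp only
    have hV : ∀ V : κ → ι → ℂ,
        (∏ a, gaussWeight (diagonal (fun i => (((Λ i)⁻¹ : ℝ) : ℂ))) (V a)) *
          principalMinor I (outerGram V) * gaussWeight (1 + (w : ℂ) • outerGram V) z
        = gaussWeight 1 z * ((∏ a, gaussWeight (tiltedPrecision Λ w z) (V a)) *
            principalMinor I (outerGram V)) := by
      intro V
      rw [gaussWeight_add, ← prod_gaussWeight_vecMulVec, tiltedPrecision]
      simp only [gaussWeight_add, Finset.prod_mul_distrib]
      ring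
    simp_rw [hV]
    rw [integral_const_mul, integral_prod_gaussWeight_mul_principalMinor_outerGram _
      (posDef_tiltedPrecision hΛ hw z), principalMinor_inv_tiltedPrecision hΛ hw,
      det_tiltedPrecision hΛ]
    have : (Real.pi ^ Fintype.card ι / (((∏ i, Λ i)⁻¹ : ℝ) *
        ((1 + w * ∑ i, Λ i * ‖z i‖ ^ 2 : ℝ) : ℂ)) : ℂ)
        = (Real.pi ^ Fintype.card ι * ∏ i, Λ i : ℝ) * (tiltFactor Λ w z : ℂ) := by
      rw [tiltFactor]
      push_cast
      rw [div_eq_mul_inv, mul_inv, inv_inv]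
      ring
    rw [this]
    push_cast
    ring

end Resolvent

section Laplace

open scoped ComplexConjugate ComplexOrder

lemma integral_pow_mul_exp_neg_mul (m : ℕ) {a : ℝ} (ha : 0 < a) :
    ∫ s in Set.Ioi (0 : ℝ), s ^ m * Real.exp (-(a * s)) = m.factorial / a ^ (m + 1) := by
  have h := Real.integral_rpow_mul_exp_neg_mul_Ioi (a := m + 1) (by positivity) ha
  rw [add_sub_cancel_right, Real.Gamma_nat_eq_factorial] at h
  simp only [Real.rpow_natCast] at h
  rw [h]
  norm_cast
  rw [one_div, inv_pow]
  ring

lemma integrableOn_pow_mul_exp_neg_mul (m : ℕ) {a : ℝ} (ha : 0 < a) :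
    IntegrableOn (fun s : ℝ => s ^ m * Real.exp (-(a * s))) (Set.Ioi 0) := by
  apply Integrable.of_integral_ne_zero
  rw [integral_pow_mul_exp_neg_mul m ha]
  positivity

lemma integral_pow_mul_exp_neg_mul_mul_sub {n : ℕ} (hn : 0 < n) {a : ℝ} (ha : 0 < a) (b : ℝ) :
    ∫ s in Set.Ioi (0 : ℝ), s ^ (n - 1) / (n - 1).factorial * Real.exp (-(a * s)) *
        (1 - s / n * b) = (a⁻¹) ^ n * (1 - a⁻¹ * b) := by
  obtain ⟨m, rfl⟩ : ∃ m, n = m + 1 := ⟨n - 1, by omega⟩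
  simp only [Nat.add_sub_cancel]
  have h : ∀ s : ℝ, s ^ m / m.factorial * Real.exp (-(a * s)) * (1 - s / (m + 1 : ℕ) * b)
      = (m.factorial : ℝ)⁻¹ * (s ^ m * Real.exp (-(a * s)))
        - b * ((m + 1).factorial : ℝ)⁻¹ * (s ^ (m + 1) * Real.exp (-(a * s))) := by
    intro s
    rw [Nat.factorial_succ]
    push_cast
    field_simp
    ring
  simp_rw [h]
  rw [integral_sub ((integrableOn_pow_mul_exp_neg_mul m ha).const_mul _)
    ((integrableOn_pow_mul_exp_neg_mul (m + 1) ha).const_mul _), integral_const_mul,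
    integral_const_mul, integral_pow_mul_exp_neg_mul m ha, integral_pow_mul_exp_neg_mul (m + 1) ha, inv_pow]
  field_simp
  ring

lemma gaussWeight_one_mul_exp {ι : Type*} [Fintype ι] [DecidableEq ι] (Λ : ι → ℝ) (w s : ℝ)
    (z : ι → ℂ) :
    gaussWeight 1 z * (Real.exp (-((1 + w * ∑ i, Λ i * ‖z i‖ ^ 2) * s)) : ℂ)
      = Real.exp (-s) * gaussWeight (diagonal fun i => ((1 + w * s * Λ i : ℝ) : ℂ)) z := by
  have h1 := gaussWeight_diagonal (fun _ : ι => 1) z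
  simp only [Complex.ofReal_one, diagonal_one] at h1
  rw [h1, gaussWeight_diagonal, ← Complex.exp_sum, ← Complex.exp_sum, Complex.ofReal_exp,
    Complex.ofReal_exp, ← Complex.exp_add, ← Complex.exp_add]
  congr 1
  push_cast
  simp only [Complex.conj_mul', Finset.sum_neg_distrib, add_mul, one_mul,
    Finset.sum_add_distrib, Finset.mul_sum, Finset.sum_mul]
  have : ∀ i, (w : ℂ) * (Λ i * (‖z i‖ : ℂ) ^ 2) * s = w * s * Λ i * (‖z i‖ : ℂ) ^ 2 := fun i => by
    ring
  simp_rw [this]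
  ring

lemma integral_gaussWeight_diagonal_mul_sub {ι : Type*} [Fintype ι] [DecidableEq ι] {d : ι → ℝ}
    (hd : ∀ i, 0 < d i) (Λ : ι → ℝ) (c : ℝ) (I : Finset ι) :
    ∫ z : ι → ℂ, gaussWeight (diagonal fun i => (d i : ℂ)) z *
        ((1 - c * ∑ i ∈ I, Λ i * ‖z i‖ ^ 2 : ℝ) : ℂ)
      = ((Real.pi ^ Fintype.card ι * ((∏ i, (d i)⁻¹) * (1 - c * ∑ i ∈ I, Λ i / d i)) : ℝ) : ℂ) := by
  have h : ∀ z : ι → ℂ, gaussWeight (diagonal fun i => (d i : ℂ)) z *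
        ((1 - c * ∑ i ∈ I, Λ i * ‖z i‖ ^ 2 : ℝ) : ℂ)
      = gaussWeight (diagonal fun i => (d i : ℂ)) z - ∑ i ∈ I, (c * Λ i : ℂ) *
        (gaussWeight (diagonal fun i => (d i : ℂ)) z * (z i * conj (z i))) := by
    intro z
    push_cast
    simp only [Complex.mul_conj']
    rw [mul_sub, mul_one, Finset.mul_sum, Finset.mul_sum]
    congr 1
    exact Finset.sum_congr rfl fun i _ => by ring
  have hI := fun i => (integrable_gaussWeight_diagonal_mul hd i i).const_mul (c * Λ i : ℂ)
  simp_rw [h]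
  rw [integral_sub (integrable_gaussWeight_diagonal hd) (integrable_finsetSum _ fun i _ => hI i),
    integral_finsetSum _ fun i _ => hI i]
  simp_rw [integral_const_mul, integral_gaussWeight_diagonal_mul hd,
    integral_gaussWeight_diagonal hd]
  push_cast
  simp only [div_eq_mul_inv, Finset.prod_mul_distrib, Finset.prod_const, Finset.card_univ,
    one_mul, mul_sub, mul_one, Finset.mul_sum]
  congr 1
  exact Finset.sum_congr rfl fun i _ => by ring

lemma integrable_gaussWeight_one_mul_exp {ι : Type*} [Fintype ι] [DecidableEq ι] {Λ : ι → ℝ}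
    (hΛ : ∀ i, 0 < Λ i) {w : ℝ} (hw : 0 ≤ w) (n : ℕ) (I : Finset ι) :
    Integrable (fun q : (ι → ℂ) × ℝ => gaussWeight 1 q.1 *
      ((q.2 ^ (n - 1) / (n - 1).factorial *
        Real.exp (-((1 + w * ∑ i, Λ i * ‖q.1 i‖ ^ 2) * q.2)) *
        (1 - q.2 / n * (w * ∑ i ∈ I, Λ i * ‖q.1 i‖ ^ 2)) : ℝ) : ℂ))
      (volume.prod (volume.restrict (Set.Ioi 0))) := by
  have h1 := integrable_gaussWeight_diagonal (ι := ι) (d := fun _ => 1) (fun _ => one_pos)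
  have h2 := fun i => integrable_gaussWeight_diagonal_mul (ι := ι) (d := fun _ => 1)
    (fun _ => one_pos) i i
  simp only [Complex.ofReal_one, diagonal_one] at h1 h2
  have h3 := fun m => (integrableOn_pow_mul_exp_neg_mul m one_pos).integrable.ofReal (𝕜 := ℂ)
  have h4 := (((h1.mul_prod (h3 (n - 1))).const_mul ((n - 1).factorial : ℂ)⁻¹).sub
    (integrable_finsetSum I fun i _ => (((h2 i).mul_prod (h3 (n - 1 + 1))).const_mul
      (((n - 1).factorial : ℂ)⁻¹ * (n : ℂ)⁻¹ * w * Λ i))))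
  have hb : ∀ᵐ q : (ι → ℂ) × ℝ ∂(volume.prod (volume.restrict (Set.Ioi 0))),
      ‖((Real.exp (-((w * ∑ i, Λ i * ‖q.1 i‖ ^ 2) * q.2)) : ℝ) : ℂ)‖ ≤ 1 := by
    have : ∀ᵐ q : (ι → ℂ) × ℝ ∂(volume.prod (volume.restrict (Set.Ioi 0))), q.2 ∈ Set.Ioi 0 :=
      Measure.quasiMeasurePreserving_snd.ae (ae_restrict_mem measurableSet_Ioi)
    filter_upwards [this] with q hq
    rw [Complex.norm_real, Real.norm_of_nonneg (Real.exp_pos _).le, Real.exp_le_one_iff,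
      neg_nonpos]
    have := one_le_tilt hΛ hw q.1
    exact mul_nonneg (by linarith) (le_of_lt hq)
  refine (h4.mul_bdd (Continuous.aestronglyMeasurable (by fun_prop)) hb).congr
    (.of_forall fun q => ?_)
  simp only [Pi.sub_apply, RCLike.ofReal_eq_complex_ofReal, Complex.mul_conj']
  have he : Real.exp (-((1 + w * ∑ i, Λ i * ‖q.1 i‖ ^ 2) * q.2))
      = Real.exp (-(1 * q.2)) * Real.exp (-((w * ∑ i, Λ i * ‖q.1 i‖ ^ 2) * q.2)) := by
    rw [← Real.exp_add]
    ring_nf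
  rw [he]
  push_cast
  generalize Complex.exp (-(w * (∑ i, (Λ i : ℂ) * (‖q.1 i‖ : ℂ) ^ 2) * q.2)) = E
  simp only [pow_succ, sub_mul, mul_sub, mul_one, Finset.sum_mul, Finset.mul_sum]
  congr 1
  · ring
  · exact Finset.sum_congr rfl fun i _ => by ring

lemma integral_gaussWeight_one_mul_tiltFactor {ι : Type*} [Fintype ι] [DecidableEq ι] {Λ : ι → ℝ}
    (hΛ : ∀ i, 0 < Λ i) {w : ℝ} (hw : 0 ≤ w) {n : ℕ} (hn : 0 < n) (I : Finset ι) :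
    ∫ z : ι → ℂ, gaussWeight 1 z * ((tiltFactor Λ w z ^ n *
          (1 - w * tiltFactor Λ w z * ∑ i ∈ I, Λ i * ‖z i‖ ^ 2) : ℝ) : ℂ)
      = ((Real.pi ^ Fintype.card ι * ∫ s in Set.Ioi (0 : ℝ),
          s ^ (n - 1) / (n - 1).factorial * Real.exp (-s) *
          ((∏ i, (1 + w * s * Λ i)⁻¹) *
            (1 - s / n * w * ∑ i ∈ I, Λ i / (1 + w * s * Λ i))) : ℝ) : ℂ) := by
  have h := integral_integral_swap (f := fun (z : ι → ℂ) (s : ℝ) => gaussWeight 1 z *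
      ((s ^ (n - 1) / (n - 1).factorial *
        Real.exp (-((1 + w * ∑ i, Λ i * ‖z i‖ ^ 2) * s)) *
        (1 - s / n * (w * ∑ i ∈ I, Λ i * ‖z i‖ ^ 2)) : ℝ) : ℂ))
      (integrable_gaussWeight_one_mul_exp hΛ hw n I)
  rw [← integral_const_mul, ← integral_complex_ofReal]
  convert h using 1
  · refine integral_congr_ae (.of_forall fun z => ?_)
    simp only
    rw [integral_const_mul, integral_complex_ofReal, integral_pow_mul_exp_neg_mul_mul_sub hn
      (zero_lt_one.trans_le (one_le_tilt hΛ hw z)), tiltFactor]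
    congr 3
    ring
  · refine setIntegral_congr_fun measurableSet_Ioi fun s hs => ?_
    have hs' : ∀ z : ι → ℂ, gaussWeight 1 z *
      ((s ^ (n - 1) / (n - 1).factorial *
        Real.exp (-((1 + w * ∑ i, Λ i * ‖z i‖ ^ 2) * s)) *
        (1 - s / n * (w * ∑ i ∈ I, Λ i * ‖z i‖ ^ 2)) : ℝ) : ℂ)
        = ((s ^ (n - 1) / (n - 1).factorial * Real.exp (-s) : ℝ) : ℂ) *
          (gaussWeight (diagonal fun i => ((1 + w * s * Λ i : ℝ) : ℂ)) z *
            ((1 - s / n * w * ∑ i ∈ I, Λ i * ‖z i‖ ^ 2 : ℝ) : ℂ)) := by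
      intro z
      have := gaussWeight_one_mul_exp Λ w s z
      rw [Complex.ofReal_mul, Complex.ofReal_mul, Complex.ofReal_mul, mul_assoc (s / n)]
      linear_combination ((s ^ (n - 1) / (n - 1).factorial : ℝ) : ℂ) *
        ((1 - s / n * (w * ∑ i ∈ I, Λ i * ‖z i‖ ^ 2) : ℝ) : ℂ) * this
    simp_rw [hs']
    rw [integral_const_mul, integral_gaussWeight_diagonal_mul_sub, ← Complex.ofReal_mul]
    · congr 1
      ring
    · intro i
      have := mul_nonneg (mul_nonneg hw (le_of_lt hs)) (hΛ i).le
      linarith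
end Laplace

section Density

open scoped ComplexConjugate ComplexOrder

/-- Transposition `(κ → ι → E) ≃ (ι → κ → E)` as a measurable equivalence. -/
def piTranspose (κ ι E : Type*) [MeasurableSpace E] : (κ → ι → E) ≃ᵐ (ι → κ → E) where
  toEquiv := Equiv.piComm fun _ _ => E
  measurable_toFun := measurable_pi_lambda _ fun i => measurable_pi_lambda _ fun a =>
    (measurable_pi_apply i).comp (measurable_pi_apply a)
  measurable_invFun := measurable_pi_lambda _ fun i => measurable_pi_lambda _ fun a =>
    (measurable_pi_apply i).comp (measurable_pi_apply a)

lemma measurePreserving_piTranspose (κ ι E : Type*) [Fintype κ] [Fintype ι] [MeasureSpace E]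
    [SigmaFinite (volume : Measure E)] : MeasurePreserving (piTranspose κ ι E) := by
  refine ⟨(piTranspose κ ι E).measurable, Eq.symm ?_⟩
  refine Measure.pi_eq_generateFrom
    (C := fun _ => Set.pi Set.univ '' Set.pi Set.univ fun _ => {s : Set E | MeasurableSet s})
    (fun _ => generateFrom_pi) (fun _ => isPiSystem_pi)
    (fun _ => Measure.FiniteSpanningSetsIn.pi fun _ => Measure.toFiniteSpanningSetsIn _) ?_
  intro s hs
  choose t ht hts using hs
  have hs' : s = fun i => Set.pi Set.univ (t i) := funext fun i => (hts i).symm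
  have hpre : piTranspose κ ι E ⁻¹' Set.pi Set.univ s
      = Set.pi Set.univ fun a => Set.pi Set.univ fun i => t i a := by
    ext W
    simp only [hs', Set.mem_preimage, Set.mem_pi, Set.mem_univ, forall_true_left]
    exact forall_comm
  rw [MeasurableEquiv.map_apply, hpre, hs']
  simp only [volume_pi, Measure.pi_pi]
  exact Finset.prod_comm

lemma outerGram_piTranspose {p n : ℕ} (W : Fin p → Fin n → ℂ) :
    outerGram (piTranspose (Fin p) (Fin n) ℂ W) = of W * (of W)ᴴ := by
  ext i j
  simp [outerGram, Matrix.mul_apply, piTranspose]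

lemma exp_neg_trace_eq_prod_gaussWeight {p n : ℕ} {Λ : Fin p → ℝ} (hΛ : ∀ j, 0 < Λ j)
    (W : Fin p → Fin n → ℂ) :
    (Real.exp (-((of W)ᴴ * (diagonal fun j => (Λ j : ℂ))⁻¹ * of W).trace.re) : ℂ)
      = ∏ a, gaussWeight (diagonal (fun i => (((Λ i)⁻¹ : ℝ) : ℂ)))
          (piTranspose (Fin p) (Fin n) ℂ W a) := by
  have hinv : (diagonal fun j => (Λ j : ℂ))⁻¹ = diagonal (fun i => (((Λ i)⁻¹ : ℝ) : ℂ)) := by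
    refine inv_eq_right_inv ?_
    rw [diagonal_mul_diagonal, ← diagonal_one]
    congr 1
    funext i
    exact_mod_cast mul_inv_cancel₀ (hΛ i).ne'
  have htr : ((of W)ᴴ * (diagonal fun j => (Λ j : ℂ))⁻¹ * of W).trace
      = ((∑ a, ∑ i, (Λ i)⁻¹ * ‖W i a‖ ^ 2 : ℝ) : ℂ) := by
    rw [hinv, trace]
    push_cast
    refine Finset.sum_congr rfl fun a _ => ?_
    rw [diag_apply, Matrix.mul_apply]
    refine Finset.sum_congr rfl fun i _ => ?_
    rw [mul_diagonal, ← Complex.conj_mul']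
    simp only [conjTranspose_apply, of_apply, RCLike.star_def]
    ring
  rw [htr, Complex.ofReal_re, Complex.ofReal_exp]
  simp only [gaussWeight_diagonal, ← Complex.exp_sum, Complex.conj_mul']
  congr 1
  push_cast
  simp only [Finset.sum_neg_distrib]
  rfl

/-- The normalisation constant `(π^p det Λ)^n`. -/
noncomputable def wishartConst (p n : ℕ) (Λ : Fin p → ℝ) : ℝ := (Real.pi ^ p * ∏ j, Λ j) ^ n

lemma wishartConst_pos (p n : ℕ) {Λ : Fin p → ℝ} (hΛ : ∀ j, 0 < Λ j) : 0 < wishartConst p n Λ :=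
  pow_pos (mul_pos (pow_pos Real.pi_pos _) (Finset.prod_pos fun j _ => hΛ j)) _

lemma measurable_wishart_density (p n : ℕ) (Λ : Fin p → ℝ) :
    Measurable fun W : Fin p → Fin n → ℂ => ENNReal.ofReal (((Real.pi ^ p * ∏ j, Λ j) ^ n)⁻¹ *
      Real.exp (-((of W)ᴴ * (diagonal fun j => (Λ j : ℂ))⁻¹ * of W).trace.re)) := by
  have : Continuous fun W : Fin p → Fin n → ℂ =>
      ((of W)ᴴ * (diagonal fun j => (Λ j : ℂ))⁻¹ * of W).trace.re := by
    have h : Continuous fun W : Fin p → Fin n → ℂ => of W := continuous_id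
    exact Complex.continuous_re.comp
      (((h.matrix_conjTranspose.matrix_mul continuous_const).matrix_mul h).matrix_trace)
  exact ((Real.continuous_exp.comp this.neg).measurable.const_mul _).ennreal_ofReal

lemma wishart_density_smul {p n : ℕ} {Λ : Fin p → ℝ} (hΛ : ∀ j, 0 < Λ j)
    (F : Matrix (Fin p) (Fin p) ℂ → ℂ) (W : Fin p → Fin n → ℂ) :
    (ENNReal.ofReal (((Real.pi ^ p * ∏ j, Λ j) ^ n)⁻¹ *
      Real.exp (-((of W)ᴴ * (diagonal fun j => (Λ j : ℂ))⁻¹ * of W).trace.re))).toReal •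
        F (of W * (of W)ᴴ)
      = ((wishartConst p n Λ : ℝ) : ℂ)⁻¹ * ((fun V : Fin n → Fin p → ℂ =>
          (∏ a, gaussWeight (diagonal (fun i => (((Λ i)⁻¹ : ℝ) : ℂ))) (V a)) * F (outerGram V))
            (piTranspose (Fin p) (Fin n) ℂ W)) := by
  have h0 := wishartConst_pos p n hΛ
  rw [wishartConst] at h0
  rw [ENNReal.toReal_ofReal (by positivity), Complex.real_smul, Complex.ofReal_mul,
    exp_neg_trace_eq_prod_gaussWeight hΛ, ← outerGram_piTranspose, wishartConst]
  push_cast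
  ring

lemma integrable_wishartMeasureComplex_iff {p n : ℕ} {Λ : Fin p → ℝ} (hΛ : ∀ j, 0 < Λ j)
    (F : Matrix (Fin p) (Fin p) ℂ → ℂ) :
    Integrable (fun W : Fin p → Fin n → ℂ => F (of W * (of W)ᴴ)) (wishartMeasureComplex p n Λ) ↔
      Integrable fun V : Fin n → Fin p → ℂ =>
        (∏ a, gaussWeight (diagonal (fun i => (((Λ i)⁻¹ : ℝ) : ℂ))) (V a)) * F (outerGram V) := by
  refine (integrable_withDensity_iff_integrable_smul' (E := ℂ) (μ := volume)
    (measurable_wishart_density p n Λ) (ae_of_all _ fun _ => ENNReal.ofReal_lt_top)).trans ?_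
  simp only [wishart_density_smul hΛ]
  have h0 : ((wishartConst p n Λ : ℝ) : ℂ)⁻¹ ≠ 0 := by
    exact_mod_cast (inv_pos.2 (wishartConst_pos p n hΛ)).ne'
  rw [integrable_const_mul_iff (isUnit_iff_ne_zero.2 h0)]
  exact MeasurePreserving.integrable_comp_emb (measurePreserving_piTranspose (Fin p) (Fin n) ℂ)
    (piTranspose (Fin p) (Fin n) ℂ).measurableEmbedding (g := fun V : Fin n → Fin p → ℂ =>
      (∏ a, gaussWeight (diagonal (fun i => (((Λ i)⁻¹ : ℝ) : ℂ))) (V a)) * F (outerGram V))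

lemma integral_wishartMeasureComplex {p n : ℕ} {Λ : Fin p → ℝ} (hΛ : ∀ j, 0 < Λ j)
    (F : Matrix (Fin p) (Fin p) ℂ → ℂ) :
    ∫ W : Fin p → Fin n → ℂ, F (of W * (of W)ᴴ) ∂(wishartMeasureComplex p n Λ)
      = ((wishartConst p n Λ : ℝ) : ℂ)⁻¹ * ∫ V : Fin n → Fin p → ℂ,
        (∏ a, gaussWeight (diagonal (fun i => (((Λ i)⁻¹ : ℝ) : ℂ))) (V a)) * F (outerGram V) := by
  refine (integral_withDensity_eq_integral_toReal_smul (E := ℂ) (μ := volume)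
    (measurable_wishart_density p n Λ) (ae_of_all _ fun _ => ENNReal.ofReal_lt_top) _).trans ?_
  simp only [wishart_density_smul hΛ]
  rw [integral_const_mul]
  congr 1
  exact MeasurePreserving.integral_comp (measurePreserving_piTranspose (Fin p) (Fin n) ℂ)
    (piTranspose (Fin p) (Fin n) ℂ).measurableEmbedding (fun V : Fin n → Fin p → ℂ =>
      (∏ a, gaussWeight (diagonal (fun i => (((Λ i)⁻¹ : ℝ) : ℂ))) (V a)) * F (outerGram V))

end Density

section LinearStatistic

open scoped ComplexConjugate ComplexOrder

lemma det_one_add_X_smul_eq_sum_principalMinor {ι : Type*} [Fintype ι] [DecidableEq ι]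
    (S : Matrix ι ι ℂ) :
    det (1 + (Polynomial.X : Polynomial ℂ) • S.map Polynomial.C)
      = ∑ I : Finset ι, Polynomial.C (principalMinor I S) * Polynomial.X ^ I.card := by
  ext k
  rw [coeff_det_one_add_X_smul_eq_sum_minors, Polynomial.finsetSum_coeff]
  simp only [Polynomial.coeff_C_mul_X_pow]
  rw [← Finset.sum_filter]
  refine Finset.sum_congr ?_ fun _ _ => rfl
  ext I
  simp [Finset.mem_powersetCard, eq_comm]

lemma det_one_add_X_smul_eq_prod_eigenvalues {ι : Type*} [Fintype ι] [DecidableEq ι]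
    {S : Matrix ι ι ℂ} (hS : S.IsHermitian) :
    det (1 + (Polynomial.X : Polynomial ℂ) • S.map Polynomial.C)
      = ∏ j, (1 + Polynomial.C (hS.eigenvalues j : ℂ) * Polynomial.X) := by
  set U := (hS.eigenvectorUnitary : Matrix ι ι ℂ) with hUdef
  have hs := hS.spectral_theorem
  rw [Unitary.conjStarAlgAut_apply] at hs
  have h2 : U.map Polynomial.C * (star U).map Polynomial.C = 1 := by
    rw [← Matrix.map_mul]
    simp [U]
  have hd : det (U.map Polynomial.C) * det ((star U).map Polynomial.C) = 1 := by
    rw [← det_mul, h2, det_one]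
  have hS' : S.map Polynomial.C = U.map Polynomial.C *
      (diagonal fun j => Polynomial.C (hS.eigenvalues j : ℂ)) * (star U).map Polynomial.C := by
    have := congrArg (fun M : Matrix ι ι ℂ => M.map Polynomial.C) hs
    simp only [Matrix.map_mul] at this
    refine this.trans ?_
    rw [diagonal_map (map_zero _)]
    rfl
  have h1 : 1 + (Polynomial.X : Polynomial ℂ) • S.map Polynomial.C
      = U.map Polynomial.C * (1 + (Polynomial.X : Polynomial ℂ) •
        diagonal fun j => Polynomial.C (hS.eigenvalues j : ℂ)) * (star U).map Polynomial.C := by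
    rw [hS', Matrix.mul_add, Matrix.add_mul, Matrix.mul_one, h2, Matrix.mul_smul, Matrix.smul_mul]
  rw [h1, det_mul, det_mul, mul_right_comm, hd, one_mul]
  rw [← diagonal_one, ← diagonal_smul, diagonal_add, det_diagonal]
  refine Finset.prod_congr rfl fun j _ => ?_
  rw [Pi.smul_apply, smul_eq_mul, mul_comm]

lemma det_one_add_smul_eq_prod_eigenvalues {ι : Type*} [Fintype ι] [DecidableEq ι]
    {S : Matrix ι ι ℂ} (hS : S.IsHermitian) (w : ℂ) :
    det (1 + w • S) = ∏ j, (1 + hS.eigenvalues j * w : ℂ) := by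
  have h := congrArg (Polynomial.eval w) (det_one_add_X_smul_eq_prod_eigenvalues hS)
  rw [Polynomial.eval_prod, ← Polynomial.coe_evalRingHom, RingHom.map_det] at h
  convert h using 2
  · ext i j
    simp [Matrix.one_apply, apply_ite, mul_comm w]
  · simp

lemma sum_eigenvalues_div {ι : Type*} [Fintype ι] [DecidableEq ι] {S : Matrix ι ι ℂ}
    (hS : S.PosSemidef) {w : ℝ} (hw : 0 ≤ w) :
    ((∑ j, hS.1.eigenvalues j / (1 + w * hS.1.eigenvalues j) : ℝ) : ℂ)
      = ∑ I : Finset ι, (I.card * (w : ℂ) ^ (I.card - 1)) *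
          (principalMinor I S / (1 + (w : ℂ) • S).det) := by
  have hne : ∀ j, (1 + hS.1.eigenvalues j * w : ℂ) ≠ 0 := fun j => by
    have := mul_nonneg (hS.eigenvalues_nonneg j) hw
    exact_mod_cast (by linarith : 0 < 1 + hS.1.eigenvalues j * w).ne'
  have h := congrArg (fun P => Polynomial.eval (w : ℂ) (Polynomial.derivative P))
    ((det_one_add_X_smul_eq_sum_principalMinor S).symm.trans
      (det_one_add_X_smul_eq_prod_eigenvalues hS.1))
  simp only [Polynomial.derivative_sum, Polynomial.derivative_X_pow,
    Polynomial.derivative_prod_finset, Polynomial.eval_finsetSum, Polynomial.eval_mul,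
    Polynomial.eval_prod, Polynomial.eval_C, Polynomial.eval_pow, Polynomial.eval_X,
    Polynomial.derivative_add, Polynomial.derivative_one, Polynomial.derivative_C_mul,
    Polynomial.derivative_X, zero_add, mul_one, Polynomial.eval_add, Polynomial.eval_one] at h
  have hsum : ∑ I : Finset ι, (I.card * (w : ℂ) ^ (I.card - 1)) *
          (principalMinor I S / (1 + (w : ℂ) • S).det)
        = (∑ I : Finset ι, principalMinor I S * I.card * (w : ℂ) ^ (I.card - 1)) /
          (1 + (w : ℂ) • S).det := by
    rw [Finset.sum_div]
    exact Finset.sum_congr rfl fun I _ => by ring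
  simp only [← mul_assoc] at h
  rw [hsum, h, det_one_add_smul_eq_prod_eigenvalues hS.1, Finset.sum_div]
  push_cast
  refine Finset.sum_congr rfl fun j _ => ?_
  rw [← Finset.prod_erase_mul _ _ (Finset.mem_univ j), mul_div_mul_left _ _
    (Finset.prod_ne_zero_iff.2 fun i _ => hne i), mul_comm (w : ℂ)]

end LinearStatistic

section MinorExpectation

open scoped ComplexConjugate ComplexOrder

variable {p n : ℕ} {Λ : Fin p → ℝ}

lemma integrable_principalMinor_div_det (hΛ : ∀ j, 0 < Λ j) {w : ℝ} (hw : 0 ≤ w)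
    (I : Finset (Fin p)) :
    Integrable (fun W : Fin p → Fin n → ℂ => principalMinor I (of W * (of W)ᴴ) /
      (1 + (w : ℂ) • (of W * (of W)ᴴ)).det) (wishartMeasureComplex p n Λ) := by
  rw [integrable_wishartMeasureComplex_iff hΛ
    fun S => principalMinor I S / (1 + (w : ℂ) • S).det]
  have h := (integrable_prod_gaussWeight_mul_principalMinor_mul_gaussWeight (κ := Fin n)
    (posDef_diagonal_inv hΛ) hw I).integral_prod_left
  have hpi : (Real.pi ^ Fintype.card (Fin p) : ℂ) ≠ 0 := by
    exact_mod_cast (pow_pos Real.pi_pos _).ne'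
  refine (h.const_mul (Real.pi ^ Fintype.card (Fin p) : ℂ)⁻¹).congr (.of_forall fun V => ?_)
  simp only
  rw [integral_const_mul, integral_gaussWeight (posDef_one_add_smul_outerGram V hw)]
  field_simp

/-- The Laplace-type integrand whose integral is the expectation of a resolvent-weighted minor. -/
noncomputable def minorKernel (n : ℕ) (Λ : Fin p → ℝ) (w : ℝ) (I : Finset (Fin p)) (s : ℝ) : ℝ :=
  s ^ (n - 1) / (n - 1).factorial * Real.exp (-s) * ((∏ i, (1 + w * s * Λ i)⁻¹) *
    (1 - s / n * w * ∑ i ∈ I, Λ i / (1 + w * s * Λ i)))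

lemma integral_principalMinor_div_det (hΛ : ∀ j, 0 < Λ j) {w : ℝ} (hw : 0 ≤ w) (hn : 0 < n)
    (I : Finset (Fin p)) :
    ∫ W : Fin p → Fin n → ℂ, principalMinor I (of W * (of W)ᴴ) /
        (1 + (w : ℂ) • (of W * (of W)ᴴ)).det ∂(wishartMeasureComplex p n Λ)
      = ((n.descFactorial I.card * (∏ i ∈ I, Λ i) *
          ∫ s in Set.Ioi (0 : ℝ), minorKernel n Λ w I s : ℝ) : ℂ) := by
  rw [integral_wishartMeasureComplex hΛ fun S => principalMinor I S / (1 + (w : ℂ) • S).det]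
  have h := integral_principalMinor_div_det_eq_integral_tilt (κ := Fin n) hΛ hw I
  rw [Fintype.card_fin n, integral_gaussWeight_one_mul_tiltFactor hΛ hw hn] at h
  simp only [mul_div_assoc] at h ⊢
  have hpi : (Real.pi ^ Fintype.card (Fin p) : ℂ) ≠ 0 := by
    exact_mod_cast (pow_pos Real.pi_pos _).ne'
  have hc : ((wishartConst p n Λ : ℝ) : ℂ) ≠ 0 := by
    exact_mod_cast (wishartConst_pos p n hΛ).ne'
  rw [inv_mul_eq_iff_eq_mul₀ hc]
  refine mul_left_cancel₀ hpi (h.trans ?_)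
  simp only [minorKernel, wishartConst, Fintype.card_fin]
  push_cast
  ring

/-- The sum of `λ / (1 + w λ)` over the eigenvalues `λ` of `W Wᴴ`. -/
noncomputable def eigenvalueResolvent (w : ℝ) (W : Fin p → Fin n → ℂ) : ℝ :=
  ∑ j, (isHermitian_mul_conjTranspose_self (of W)).eigenvalues j /
    (1 + w * (isHermitian_mul_conjTranspose_self (of W)).eigenvalues j)

lemma eigenvalueResolvent_eq {w : ℝ} (hw : 0 ≤ w) (W : Fin p → Fin n → ℂ) :
    ((eigenvalueResolvent w W : ℝ) : ℂ) = ∑ I : Finset (Fin p),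
      (I.card * (w : ℂ) ^ (I.card - 1)) * (principalMinor I (of W * (of W)ᴴ) /
        (1 + (w : ℂ) • (of W * (of W)ᴴ)).det) :=
  sum_eigenvalues_div (posSemidef_self_mul_conjTranspose (of W)) hw

lemma integrable_eigenvalueResolvent (hΛ : ∀ j, 0 < Λ j) {w : ℝ} (hw : 0 ≤ w) :
    Integrable (eigenvalueResolvent w : (Fin p → Fin n → ℂ) → ℝ)
      (wishartMeasureComplex p n Λ) := by
  have h : Integrable (fun W : Fin p → Fin n → ℂ => ((eigenvalueResolvent w W : ℝ) : ℂ))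
      (wishartMeasureComplex p n Λ) := by
    simp_rw [eigenvalueResolvent_eq hw]
    exact integrable_finsetSum _ fun I _ =>
      (integrable_principalMinor_div_det hΛ hw I).const_mul _
  exact h.re

lemma integral_eigenvalueResolvent (hΛ : ∀ j, 0 < Λ j) {w : ℝ} (hw : 0 ≤ w) (hn : 0 < n) :
    ∫ W : Fin p → Fin n → ℂ, eigenvalueResolvent w W ∂(wishartMeasureComplex p n Λ)
      = ∑ I : Finset (Fin p), (I.card * w ^ (I.card - 1)) * (n.descFactorial I.card *
          (∏ i ∈ I, Λ i) * ∫ s in Set.Ioi (0 : ℝ), minorKernel n Λ w I s) := by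
  apply Complex.ofReal_injective
  rw [← integral_complex_ofReal]
  simp_rw [eigenvalueResolvent_eq hw]
  rw [integral_finsetSum _ fun I _ => (integrable_principalMinor_div_det hΛ hw I).const_mul _]
  push_cast
  refine Finset.sum_congr rfl fun I _ => ?_
  rw [integral_const_mul, integral_principalMinor_div_det hΛ hw hn]
  push_cast
  rfl

lemma isProbabilityMeasure_wishartMeasureComplex (hΛ : ∀ j, 0 < Λ j) (hn : 0 < n) :
    IsProbabilityMeasure (wishartMeasureComplex p n Λ) := by
  have h := integral_principalMinor_div_det (n := n) hΛ le_rfl hn ∅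
  have h1 : ∫ s in Set.Ioi (0 : ℝ), minorKernel n Λ 0 ∅ s = 1 := by
    have := integral_pow_mul_exp_neg_mul (n - 1) one_pos
    simp only [one_mul, one_pow, div_one] at this
    simp only [minorKernel, zero_mul, add_zero, inv_one, Finset.prod_const_one, mul_zero, sub_zero,
      mul_one, div_mul_eq_mul_div]
    rw [integral_div, this, div_self (by positivity)]
  rw [h1] at h
  simp only [principalMinor, det_isEmpty, Complex.ofReal_zero, zero_smul, add_zero, det_one, div_one,
    Finset.card_empty, Nat.descFactorial_zero, Nat.cast_one, Finset.prod_empty, mul_one,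
    integral_const, Complex.real_smul, Complex.ofReal_one, Complex.ofReal_eq_one] at h
  exact ⟨(ENNReal.toReal_eq_one_iff _).1 h⟩

end MinorExpectation

section SymmetricFunctions

variable {p : ℕ}

lemma sum_powersetCard_succ_sum_mem {α M : Type*} [Fintype α] [DecidableEq α] [AddCommMonoid M]
    (b : ℕ) (F : Finset α → α → M) :
    ∑ J ∈ Finset.univ.powersetCard (b + 1), ∑ j ∈ J, F J j
      = ∑ I ∈ Finset.univ.powersetCard b, ∑ j ∈ Iᶜ, F (insert j I) j := by
  rw [Finset.sum_sigma', Finset.sum_sigma']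
  refine Finset.sum_bij' (fun q _ => ⟨q.1.erase q.2, q.2⟩) (fun q _ => ⟨insert q.2 q.1, q.2⟩)
    ?_ ?_ ?_ ?_ ?_
  · rintro ⟨J, j⟩ h
    simp only [Finset.mem_sigma, Finset.mem_powersetCard_univ, Finset.mem_compl,
      Finset.notMem_erase, not_false_eq_true, and_true] at h ⊢
    rw [Finset.card_erase_of_mem h.2, h.1, Nat.add_sub_cancel]
  · rintro ⟨I, j⟩ h
    simp only [Finset.mem_sigma, Finset.mem_powersetCard_univ, Finset.mem_compl,
      Finset.mem_insert_self, and_true] at h ⊢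
    rw [Finset.card_insert_of_notMem h.2, h.1]
  · rintro ⟨J, j⟩ h
    simp only [Finset.mem_sigma] at h
    simp [Finset.insert_erase h.2]
  · rintro ⟨I, j⟩ h
    simp only [Finset.mem_sigma, Finset.mem_compl] at h
    simp [Finset.erase_insert h.2]
  · rintro ⟨J, j⟩ h
    simp only [Finset.mem_sigma] at h
    simp [Finset.insert_erase h.2]

lemma esymm_eq_zero {s : Finset (Fin p)} (v : Fin p → ℝ) {k : ℕ} (hk : s.card < k) :
    esymm s v k = 0 := by
  rw [esymm, Finset.powersetCard_eq_empty.2 hk, Finset.sum_empty]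

/-- The sum over subsets `I` of size `b` of `∏_{i ∈ I} Λ i` times `∑_{j ∈ I} Λ j / (1 + x Λ j)`. -/
noncomputable def weightedEsymm (Λ : Fin p → ℝ) (b : ℕ) (x : ℝ) : ℝ :=
  ∑ I ∈ Finset.univ.powersetCard b, (∏ i ∈ I, Λ i) * ∑ j ∈ I, Λ j / (1 + x * Λ j)

lemma weightedEsymm_succ (Λ : Fin p → ℝ) (b : ℕ) {x : ℝ} (hx : ∀ j, 1 + x * Λ j ≠ 0) :
    x * weightedEsymm Λ (b + 1) x = weightedEsymm Λ b x
      + (b + 1) * esymm Finset.univ Λ (b + 1)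
      - (∑ j, Λ j / (1 + x * Λ j)) * esymm Finset.univ Λ b := by
  have h1 : x * weightedEsymm Λ (b + 1) x = (b + 1) * esymm Finset.univ Λ (b + 1)
      - ∑ J ∈ Finset.univ.powersetCard (b + 1), ∑ j ∈ J, (∏ i ∈ J, Λ i) * (1 + x * Λ j)⁻¹ := by
    rw [weightedEsymm, esymm, Finset.mul_sum, Finset.mul_sum, ← Finset.sum_sub_distrib]
    refine Finset.sum_congr rfl fun J hJ => ?_
    rw [Finset.mem_powersetCard_univ] at hJ
    have : ((b : ℝ) + 1) * ∏ i ∈ J, Λ i = ∑ j ∈ J, ∏ i ∈ J, Λ i := by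
      rw [Finset.sum_const, hJ, nsmul_eq_mul]
      push_cast
      rfl
    rw [this, ← Finset.sum_sub_distrib, Finset.mul_sum, Finset.mul_sum]
    refine Finset.sum_congr rfl fun j _ => ?_
    field_simp [hx j]
    ring
  rw [h1, sum_powersetCard_succ_sum_mem, weightedEsymm, esymm, esymm, Finset.mul_sum,
    Finset.mul_sum]
  have h2 : ∀ I ∈ Finset.univ.powersetCard b,
      ∑ j ∈ Iᶜ, (∏ i ∈ insert j I, Λ i) * (1 + x * Λ j)⁻¹
        = (∑ j, Λ j / (1 + x * Λ j)) * (∏ i ∈ I, Λ i)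
          - (∏ i ∈ I, Λ i) * ∑ j ∈ I, Λ j / (1 + x * Λ j) := by
    intro I _
    rw [← Finset.sum_add_sum_compl I fun j => Λ j / (1 + x * Λ j), add_mul, mul_comm (∑ j ∈ I, _),
      add_sub_cancel_left, Finset.sum_mul]
    refine Finset.sum_congr rfl fun j hj => ?_
    rw [Finset.prod_insert (Finset.mem_compl.1 hj)]
    ring
  rw [Finset.sum_congr rfl h2, Finset.sum_sub_distrib]
  ring

/-- The `b`-fold iterated division by `x`, discarding remainders, of
`(∏ i, (1 + x Λ i) - 1) / x`. -/
noncomputable def esymmTail (Λ : Fin p → ℝ) (b : ℕ) (x : ℝ) : ℝ :=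
  ∑ k ∈ Finset.range p, esymm Finset.univ Λ (b + 1 + k) * x ^ k

lemma esymmTail_eq_zero (Λ : Fin p → ℝ) {b : ℕ} (hb : p ≤ b) (x : ℝ) : esymmTail Λ b x = 0 :=
  Finset.sum_eq_zero fun k _ => by
    rw [esymm_eq_zero _ (by rw [Finset.card_fin]; omega), zero_mul]

lemma esymmTail_eq (Λ : Fin p → ℝ) (b : ℕ) (x : ℝ) :
    esymmTail Λ b x = esymm Finset.univ Λ (b + 1) + x * esymmTail Λ (b + 1) x := by
  have h : esymmTail Λ b x = ∑ k ∈ Finset.range (p + 1), esymm Finset.univ Λ (b + 1 + k) * x ^ k := by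
    rw [Finset.sum_range_succ, esymm_eq_zero (k := b + 1 + p) _ (by rw [Finset.card_fin]; omega),
      zero_mul, add_zero, esymmTail]
  rw [h, Finset.sum_range_succ', esymmTail, Finset.mul_sum, add_comm]
  simp only [add_zero, pow_zero, mul_one]
  congr 1
  refine Finset.sum_congr rfl fun k _ => ?_
  rw [show b + 1 + (k + 1) = b + 1 + 1 + k by ring]
  ring

lemma differentiable_esymmTail (Λ : Fin p → ℝ) (b : ℕ) : Differentiable ℝ (esymmTail Λ b) := by
  unfold esymmTail
  fun_prop

lemma deriv_esymmTail (Λ : Fin p → ℝ) (b : ℕ) (x : ℝ) :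
    deriv (esymmTail Λ b) x = esymmTail Λ (b + 1) x + x * deriv (esymmTail Λ (b + 1)) x := by
  have h : esymmTail Λ b =
      fun x => esymm Finset.univ Λ (b + 1) + x * esymmTail Λ (b + 1) x :=
    funext fun x => esymmTail_eq Λ b x
  conv_lhs => rw [h]
  rw [deriv_const_add]
  have := ((hasDerivAt_id x).mul (differentiable_esymmTail Λ (b + 1) x).hasDerivAt).deriv
  exact this.trans (by simp)

lemma weightedEsymm_succ_eq (Λ : Fin p → ℝ) {x : ℝ} (hx : ∀ j, 1 + x * Λ j ≠ 0) (a : ℕ) :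
    weightedEsymm Λ (a + 1) x = (∑ j, Λ j / (1 + x * Λ j)) * esymmTail Λ a x
      - deriv (esymmTail Λ a) x - (a + 1) * esymmTail Λ (a + 1) x := by
  have key : ∀ k a, p ≤ a + k → weightedEsymm Λ (a + 1) x
      = (∑ j, Λ j / (1 + x * Λ j)) * esymmTail Λ a x
        - deriv (esymmTail Λ a) x - (a + 1) * esymmTail Λ (a + 1) x := by
    intro k
    induction k with
    | zero =>
      intro a ha
      have h0 : esymmTail Λ a = fun _ => 0 := funext fun x => esymmTail_eq_zero Λ ha x
      have h1 : Finset.powersetCard (a + 1) (Finset.univ : Finset (Fin p)) = ∅ :=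
        Finset.powersetCard_eq_empty.2 (by rw [Finset.card_fin]; omega)
      rw [esymmTail_eq_zero Λ (by omega : p ≤ a + 1), h0, weightedEsymm, h1]
      simp
    | succ k ih =>
      intro a ha
      have h1 := ih (a + 1) (by omega)
      have h2 := weightedEsymm_succ Λ (a + 1) hx
      rw [h1] at h2
      push_cast at h2
      have h3 := esymmTail_eq Λ a x
      have h4 := esymmTail_eq Λ (a + 1) x
      have h5 := deriv_esymmTail Λ a x
      linear_combination (-1 : ℝ) * h2 - (∑ j, Λ j / (1 + x * Λ j)) * h3 + h5 + (a + 2) * h4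
  exact key p a (Nat.le_add_left _ _)

end SymmetricFunctions

section PartialFractions

variable {p : ℕ}

lemma esymm_univ_succ (v : Fin p → ℝ) (i : Fin p) (m : ℕ) :
    esymm Finset.univ v (m + 1)
      = esymm (Finset.univ.erase i) v (m + 1) + v i * esymm (Finset.univ.erase i) v m := by
  have hi : i ∉ Finset.univ.erase i := Finset.notMem_erase i _
  have hnot : ∀ {k : ℕ} {t : Finset (Fin p)},
      t ∈ (Finset.univ.erase i).powersetCard k → i ∉ t := fun ht h =>
    hi ((Finset.mem_powersetCard.1 ht).1 h)
  conv_lhs => rw [← Finset.insert_erase (Finset.mem_univ i)]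
  rw [esymm, Finset.powersetCard_succ_insert hi, Finset.sum_union, Finset.sum_image]
  · rw [esymm, esymm, Finset.mul_sum]
    congr 1
    exact Finset.sum_congr rfl fun t ht => Finset.prod_insert (hnot ht)
  · intro t ht t' ht' h
    rw [← Finset.erase_insert (hnot ht), ← Finset.erase_insert (hnot ht'), h]
  · rw [Finset.disjoint_left]
    intro t ht h
    obtain ⟨t', -, rfl⟩ := Finset.mem_image.1 h
    exact hnot ht (Finset.mem_insert_self i t')

lemma esymm_neg (s : Finset (Fin p)) (v : Fin p → ℝ) (k : ℕ) :
    esymm s (fun l => -v l) k = (-1) ^ k * esymm s v k := by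
  rw [esymm, esymm, Finset.mul_sum]
  refine Finset.sum_congr rfl fun t ht => ?_
  rw [Finset.prod_neg, (Finset.mem_powersetCard.1 ht).2]

lemma prod_one_add_mul_eq_sum_esymm (s : Finset (Fin p)) (v : Fin p → ℝ) (y : ℝ) :
    ∏ l ∈ s, (1 + v l * y) = ∑ k ∈ Finset.range (s.card + 1), esymm s v k * y ^ k := by
  rw [Finset.prod_one_add, Finset.sum_powerset]
  refine Finset.sum_congr rfl fun k _ => ?_
  rw [esymm, Finset.sum_mul]
  refine Finset.sum_congr rfl fun t ht => ?_
  rw [Finset.prod_mul_distrib, Finset.prod_const, (Finset.mem_powersetCard.1 ht).2]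

lemma prod_one_sub_div_ne_zero {Λ : Fin p → ℝ} (hΛ : ∀ j, 0 < Λ j)
    (hdist : Function.Injective Λ) (j : Fin p) :
    ∏ l ∈ Finset.univ.erase j, (1 - Λ l / Λ j) ≠ 0 := by
  refine Finset.prod_ne_zero_iff.2 fun l hl => ?_
  rw [sub_ne_zero, ne_comm, Ne, div_eq_one_iff_eq (hΛ j).ne']
  exact fun h => Finset.ne_of_mem_erase hl (hdist h)

lemma esymmTail_neg_inv {Λ : Fin p → ℝ} (hΛ : ∀ j, 0 < Λ j) (b : ℕ) (i : Fin p) :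
    esymmTail Λ b (-(Λ i)⁻¹) = Λ i * esymm (Finset.univ.erase i) Λ b := by
  set g : ℕ → ℝ := fun k => esymm (Finset.univ.erase i) Λ (b + k) * (-(Λ i)⁻¹) ^ k with hg
  have h : ∀ k, esymm Finset.univ Λ (b + 1 + k) * (-(Λ i)⁻¹) ^ k
      = -Λ i * (g (k + 1) - g k) := by
    intro k
    have := (hΛ i).ne'
    rw [hg, show b + 1 + k = (b + k) + 1 by ring, esymm_univ_succ _ i]
    simp only [pow_succ, ← add_assoc]
    field_simp
    ring
  rw [esymmTail, Finset.sum_congr rfl fun k _ => h k, ← Finset.mul_sum, Finset.sum_range_sub]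
  have hp : esymm (Finset.univ.erase i) Λ (b + p) = 0 := by
    refine esymm_eq_zero _ ?_
    rw [Finset.card_erase_of_mem (Finset.mem_univ i), Finset.card_fin]
    have := i.pos
    omega
  simp [hg, hp]

lemma sum_esymm_mul_prod_eq_pow_mul_esymmTail {Λ : Fin p → ℝ} (hΛ : ∀ j, 0 < Λ j)
    (hdist : Function.Injective Λ) (b : ℕ) (x : ℝ) :
    ∑ j, esymm (Finset.univ.erase j) Λ b / (∏ l ∈ Finset.univ.erase j, (1 - Λ l / Λ j)) *
        ((-(Λ j)⁻¹) ^ b * Λ j) * ∏ l ∈ Finset.univ.erase j, (1 + x * Λ l)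
      = x ^ b * esymmTail Λ b x := by
  have hcard : ∀ j : Fin p, (Finset.univ.erase j).card < p := fun j => by
    rw [Finset.card_erase_of_mem (Finset.mem_univ j), Finset.card_fin]
    exact Nat.sub_lt j.pos one_pos
  set c : Fin p → ℝ := fun j => esymm (Finset.univ.erase j) Λ b /
    (∏ l ∈ Finset.univ.erase j, (1 - Λ l / Λ j)) * ((-(Λ j)⁻¹) ^ b * Λ j) with hc
  set P : Polynomial ℝ := ∑ j, Polynomial.C (c j) *
    ∏ l ∈ Finset.univ.erase j, (1 + Polynomial.X * Polynomial.C (Λ l)) with hP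
  set R : Polynomial ℝ := ∑ k ∈ Finset.range p,
    Polynomial.C (esymm Finset.univ Λ (b + 1 + k)) * Polynomial.X ^ (b + k) with hR
  have hPe : ∀ y, P.eval y = ∑ j, c j * ∏ l ∈ Finset.univ.erase j, (1 + y * Λ l) := fun y => by
    simp only [hP, Polynomial.eval_finsetSum, Polynomial.eval_mul, Polynomial.eval_C,
      Polynomial.eval_prod, Polynomial.eval_add, Polynomial.eval_one, Polynomial.eval_X]
  have hRe : ∀ y, R.eval y = y ^ b * esymmTail Λ b y := fun y => by
    rw [esymmTail, Finset.mul_sum, hR, Polynomial.eval_finsetSum]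
    refine Finset.sum_congr rfl fun k _ => ?_
    rw [Polynomial.eval_C_mul, Polynomial.eval_pow, Polynomial.eval_X]
    ring
  have hPd : P.degree < p := by
    rw [← Polynomial.mem_degreeLT]
    refine Submodule.sum_mem _ fun j _ => ?_
    rw [← Polynomial.smul_eq_C_mul]
    refine Submodule.smul_mem _ _ ?_
    rw [Polynomial.mem_degreeLT]
    refine Polynomial.degree_le_natDegree.trans_lt ?_
    refine WithBot.coe_lt_coe.2 (lt_of_le_of_lt ?_ (hcard j))
    refine (Polynomial.natDegree_prod_le _ _).trans ?_
    refine (Finset.sum_le_card_nsmul _ _ 1 fun l _ => ?_).trans (by simp)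
    compute_degree
  have hRd : R.degree < p := by
    rw [← Polynomial.mem_degreeLT]
    refine Submodule.sum_mem _ fun k _ => ?_
    by_cases hk : p < b + 1 + k
    · rw [esymm_eq_zero _ (by rwa [Finset.card_fin]), map_zero, zero_mul]
      exact Submodule.zero_mem _
    · rw [Polynomial.mem_degreeLT]
      refine (Polynomial.degree_C_mul_X_pow_le _ _).trans_lt ?_
      exact_mod_cast (by omega : b + k < p)
  have hPR : P = R := by
    refine Polynomial.eq_of_degrees_lt_of_eval_index_eq (v := fun i => -(Λ i)⁻¹) Finset.univ
      (fun i _ j _ h => hdist (inv_injective (neg_injective h)))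
      (by rwa [Finset.card_fin]) (by rwa [Finset.card_fin]) fun i _ => ?_
    rw [hPe, hRe, esymmTail_neg_inv hΛ, Finset.sum_eq_single i]
    · have h1 : ∏ l ∈ Finset.univ.erase i, (1 + -(Λ i)⁻¹ * Λ l)
          = ∏ l ∈ Finset.univ.erase i, (1 - Λ l / Λ i) :=
        Finset.prod_congr rfl fun l _ => by ring
      have h2 := prod_one_sub_div_ne_zero hΛ hdist i
      rw [h1, hc]
      simp only
      generalize ∏ l ∈ Finset.univ.erase i, (1 - Λ l / Λ i) = D at h2
      rw [mul_right_comm, div_mul_cancel₀ _ h2]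
      ring
    · intro j _ hji
      rw [Finset.prod_eq_zero (Finset.mem_erase.2 ⟨hji.symm, Finset.mem_univ i⟩), mul_zero]
      rw [neg_mul, inv_mul_cancel₀ (hΛ i).ne', add_neg_cancel]
    · exact fun h => absurd (Finset.mem_univ i) h
  rw [← hRe, ← hPR, hPe]

lemma sum_esymm_div_eq_pow_mul_esymmTail {Λ : Fin p → ℝ} (hΛ : ∀ j, 0 < Λ j)
    (hdist : Function.Injective Λ) (b : ℕ) {x : ℝ} (hx : ∀ j, 1 + x * Λ j ≠ 0) :
    ∑ j, esymm (Finset.univ.erase j) Λ b / (∏ l ∈ Finset.univ.erase j, (1 - Λ l / Λ j)) *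
        ((-(Λ j)⁻¹) ^ b * Λ j) / (1 + x * Λ j)
      = x ^ b * ((∏ i, (1 + x * Λ i)⁻¹) * esymmTail Λ b x) := by
  rw [mul_left_comm, ← sum_esymm_mul_prod_eq_pow_mul_esymmTail hΛ hdist, Finset.mul_sum]
  refine Finset.sum_congr rfl fun j _ => ?_
  rw [← Finset.mul_prod_erase Finset.univ (fun i => (1 + x * Λ i)⁻¹) (Finset.mem_univ j),
    Finset.prod_inv_distrib]
  have h : ∏ l ∈ Finset.univ.erase j, (1 + x * Λ l) ≠ 0 :=
    Finset.prod_ne_zero_iff.2 fun l _ => hx l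
  generalize ∏ l ∈ Finset.univ.erase j, (1 + x * Λ l) = D at h
  field_simp

end PartialFractions

section IntegrationByParts

variable {p : ℕ}

lemma integrableOn_pow_mul_exp_neg_mul_bdd (k : ℕ) {h : ℝ → ℝ} (hm : Measurable h) {C : ℝ}
    (hC : ∀ s, 0 < s → |h s| ≤ C) :
    IntegrableOn (fun s : ℝ => s ^ k * Real.exp (-s) * h s) (Set.Ioi 0) := by
  have h1 := integrableOn_pow_mul_exp_neg_mul k one_pos
  simp only [one_mul] at h1
  exact h1.mul_bdd (c := C) hm.aestronglyMeasurable
    ((ae_restrict_iff' measurableSet_Ioi).2 (.of_forall fun s hs => hC s hs))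

/-- The product of `(1 + x Λ i)⁻¹` over all `i`. -/
noncomputable def resolventProd (Λ : Fin p → ℝ) (x : ℝ) : ℝ := ∏ i, (1 + x * Λ i)⁻¹

lemma measurable_resolventProd (Λ : Fin p → ℝ) : Measurable (resolventProd Λ) := by
  unfold resolventProd
  fun_prop

lemma one_add_mul_pos {Λ : Fin p → ℝ} (hΛ : ∀ j, 0 < Λ j) {x : ℝ} (hx : 0 ≤ x) (i : Fin p) :
    1 ≤ 1 + x * Λ i := le_add_of_nonneg_right (mul_nonneg hx (hΛ i).le)

lemma resolventProd_nonneg {Λ : Fin p → ℝ} (hΛ : ∀ j, 0 < Λ j) {x : ℝ} (hx : 0 ≤ x) :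
    0 ≤ resolventProd Λ x :=
  Finset.prod_nonneg fun i _ => inv_nonneg.2 (zero_le_one.trans (one_add_mul_pos hΛ hx i))

lemma resolventProd_le_one {Λ : Fin p → ℝ} (hΛ : ∀ j, 0 < Λ j) {x : ℝ} (hx : 0 ≤ x) :
    resolventProd Λ x ≤ 1 :=
  Finset.prod_le_one (fun i _ => inv_nonneg.2 (zero_le_one.trans (one_add_mul_pos hΛ hx i)))
    fun i _ => inv_le_one_of_one_le₀ (one_add_mul_pos hΛ hx i)

lemma sum_div_one_add_mem_Icc {Λ : Fin p → ℝ} (hΛ : ∀ j, 0 < Λ j) {x : ℝ} (hx : 0 ≤ x)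
    (I : Finset (Fin p)) : ∑ j ∈ I, Λ j / (1 + x * Λ j) ∈ Set.Icc 0 (∑ j ∈ I, Λ j) :=
  ⟨Finset.sum_nonneg fun i _ => div_nonneg (hΛ i).le (zero_le_one.trans (one_add_mul_pos hΛ hx i)),
    Finset.sum_le_sum fun i _ => div_le_self (hΛ i).le (one_add_mul_pos hΛ hx i)⟩

lemma abs_resolventProd_mul_le {Λ : Fin p → ℝ} (hΛ : ∀ j, 0 < Λ j) {x : ℝ} (hx : 0 ≤ x) {y C : ℝ}
    (hy : y ∈ Set.Icc 0 C) : |resolventProd Λ x * y| ≤ C := by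
  rw [abs_of_nonneg (mul_nonneg (resolventProd_nonneg hΛ hx) hy.1)]
  exact (mul_le_of_le_one_left hy.1 (resolventProd_le_one hΛ hx)).trans hy.2

lemma integrableOn_resolventProd {Λ : Fin p → ℝ} (hΛ : ∀ j, 0 < Λ j) {w : ℝ} (hw : 0 ≤ w)
    (k : ℕ) : IntegrableOn (fun s : ℝ => s ^ k * Real.exp (-s) * resolventProd Λ (w * s))
      (Set.Ioi 0) := by
  refine integrableOn_pow_mul_exp_neg_mul_bdd k (C := 1)
    ((measurable_resolventProd Λ).comp (measurable_const_mul w)) fun s hs => ?_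
  have := abs_resolventProd_mul_le (y := 1) hΛ (mul_nonneg hw hs.le) ⟨zero_le_one, le_rfl⟩
  rwa [mul_one] at this

lemma integrableOn_resolventProd_mul_sum {Λ : Fin p → ℝ} (hΛ : ∀ j, 0 < Λ j) {w : ℝ} (hw : 0 ≤ w)
    (k : ℕ) (I : Finset (Fin p)) :
    IntegrableOn (fun s : ℝ => s ^ k * Real.exp (-s) *
      (resolventProd Λ (w * s) * ∑ j ∈ I, Λ j / (1 + w * s * Λ j))) (Set.Ioi 0) := by
  refine integrableOn_pow_mul_exp_neg_mul_bdd k (C := ∑ j ∈ I, Λ j) ?_ fun s hs =>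
    abs_resolventProd_mul_le hΛ (mul_nonneg hw hs.le)
      (sum_div_one_add_mem_Icc hΛ (mul_nonneg hw hs.le) I)
  refine ((measurable_resolventProd Λ).comp (measurable_const_mul w)).mul ?_
  fun_prop

lemma integrableOn_resolventProd_mul_weightedEsymm {Λ : Fin p → ℝ} (hΛ : ∀ j, 0 < Λ j) {w : ℝ}
    (hw : 0 ≤ w) (k b : ℕ) :
    IntegrableOn (fun s : ℝ => s ^ k * Real.exp (-s) *
      (resolventProd Λ (w * s) * weightedEsymm Λ b (w * s))) (Set.Ioi 0) := by
  have h : IntegrableOn (fun s : ℝ => ∑ I ∈ Finset.univ.powersetCard b, (∏ i ∈ I, Λ i) *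
      (s ^ k * Real.exp (-s) *
        (resolventProd Λ (w * s) * ∑ j ∈ I, Λ j / (1 + w * s * Λ j)))) (Set.Ioi 0) :=
    integrable_finsetSum _ fun I _ =>
      (integrableOn_resolventProd_mul_sum hΛ hw k I).const_mul (∏ i ∈ I, Λ i)
  refine h.congr_fun (fun s _ => ?_) measurableSet_Ioi
  simp only [weightedEsymm, Finset.mul_sum (Finset.univ.powersetCard b)]
  exact Finset.sum_congr rfl fun I _ => by ring

lemma integrableOn_resolventProd_mul_esymmTail {Λ : Fin p → ℝ} (hΛ : ∀ j, 0 < Λ j) {w : ℝ}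
    (hw : 0 ≤ w) (k b : ℕ) :
    IntegrableOn (fun s : ℝ => s ^ k * Real.exp (-s) *
      (resolventProd Λ (w * s) * esymmTail Λ b (w * s))) (Set.Ioi 0) := by
  have h : IntegrableOn (fun s : ℝ => ∑ i ∈ Finset.range p,
      esymm Finset.univ Λ (b + 1 + i) * w ^ i *
        (s ^ (k + i) * Real.exp (-s) * resolventProd Λ (w * s))) (Set.Ioi 0) :=
    integrable_finsetSum _ fun i _ => (integrableOn_resolventProd hΛ hw (k + i)).const_mul _
  refine h.congr_fun (fun s _ => ?_) measurableSet_Ioi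
  simp only [esymmTail, Finset.mul_sum]
  exact Finset.sum_congr rfl fun i _ => by ring

lemma hasDerivAt_resolventProd {Λ : Fin p → ℝ} {x : ℝ} (hx : ∀ j, 1 + x * Λ j ≠ 0) :
    HasDerivAt (resolventProd Λ) (-(resolventProd Λ x * ∑ j, Λ j / (1 + x * Λ j))) x := by
  have h : ∀ j ∈ (Finset.univ : Finset (Fin p)), HasDerivAt (fun x => (1 + x * Λ j)⁻¹)
      (-(Λ j) / (1 + x * Λ j) ^ 2) x := fun j _ =>
    (((hasDerivAt_id x).mul_const (Λ j)).const_add 1 |>.congr_deriv (one_mul _)).fun_inv (hx j)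
  refine (HasDerivAt.fun_finsetProd h).congr_deriv ?_
  rw [Finset.mul_sum, ← Finset.sum_neg_distrib]
  refine Finset.sum_congr rfl fun j _ => ?_
  rw [resolventProd, ← Finset.mul_prod_erase Finset.univ (fun i => (1 + x * Λ i)⁻¹)
    (Finset.mem_univ j), smul_eq_mul]
  have := hx j
  field_simp

/-- The moment integrals of the divided differences of `∏ i, (1 + x Λ i)`. -/
noncomputable def tailMoment (n : ℕ) (Λ : Fin p → ℝ) (w : ℝ) (a : ℕ) : ℝ :=
  ∫ s in Set.Ioi (0 : ℝ), s ^ n * Real.exp (-s) *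
    (resolventProd Λ (w * s) * esymmTail Λ a (w * s))

lemma integral_esymm_sub_weightedEsymm {Λ : Fin p → ℝ} (hΛ : ∀ j, 0 < Λ j) {w : ℝ} (hw : 0 ≤ w)
    {n : ℕ} (hn : 0 < n) (a : ℕ) :
    ∫ s in Set.Ioi (0 : ℝ), s ^ (n - 1) * Real.exp (-s) * (resolventProd Λ (w * s) *
        (n * esymm Finset.univ Λ (a + 1) - s * w * weightedEsymm Λ (a + 1) (w * s)))
      = tailMoment n Λ w a - w * (n - (a + 1)) * tailMoment n Λ w (a + 1) := by
  have hpow : ∀ s : ℝ, s ^ n = s * s ^ (n - 1) := fun s => by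
    rw [← pow_succ', Nat.sub_add_cancel hn]
  have hI1 : IntegrableOn (fun s : ℝ => s ^ (n - 1) * Real.exp (-s) * (resolventProd Λ (w * s) *
      (n * esymm Finset.univ Λ (a + 1) - s * w * weightedEsymm Λ (a + 1) (w * s))))
      (Set.Ioi 0) := by
    refine (((integrableOn_resolventProd hΛ hw (n - 1)).const_mul
      (n * esymm Finset.univ Λ (a + 1))).sub
      ((integrableOn_resolventProd_mul_weightedEsymm hΛ hw n (a + 1)).const_mul w)).congr
      (.of_forall fun s => ?_)
    simp only [Pi.sub_apply, hpow]
    ring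
  have hI2 := integrableOn_resolventProd_mul_esymmTail hΛ hw n a
  have hI3 := (integrableOn_resolventProd_mul_esymmTail hΛ hw n (a + 1)).const_mul
    (w * (n - (a + 1)))
  have hderiv : ∀ s ∈ Set.Ici (0 : ℝ), HasDerivAt (fun s : ℝ => s ^ n * Real.exp (-s) *
      (resolventProd Λ (w * s) * esymmTail Λ a (w * s)))
      (s ^ (n - 1) * Real.exp (-s) * (resolventProd Λ (w * s) *
        (n * esymm Finset.univ Λ (a + 1) - s * w * weightedEsymm Λ (a + 1) (w * s)))
        + w * (n - (a + 1)) * (s ^ n * Real.exp (-s) *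
          (resolventProd Λ (w * s) * esymmTail Λ (a + 1) (w * s)))
        - s ^ n * Real.exp (-s) * (resolventProd Λ (w * s) * esymmTail Λ a (w * s))) s := by
    intro s hs
    have hx : ∀ j, 1 + w * s * Λ j ≠ 0 := fun j =>
      (zero_lt_one.trans_le (one_add_mul_pos hΛ (mul_nonneg hw hs) j)).ne'
    have h1 : HasDerivAt (fun s => w * s) w s := by
      simpa using (hasDerivAt_id s).const_mul w
    have h2 := ((hasDerivAt_pow n s).mul ((hasDerivAt_id s).neg.exp)).mul
      (((hasDerivAt_resolventProd hx).comp s h1).mul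
        ((differentiable_esymmTail Λ a (w * s)).hasDerivAt.comp s h1))
    refine h2.congr_deriv ?_
    simp only [Pi.mul_apply, Function.comp_apply, id_eq, Pi.neg_apply]
    rw [weightedEsymm_succ_eq Λ hx, hpow]
    have h3 := esymmTail_eq Λ a (w * s)
    linear_combination (n * s ^ (n - 1) * Real.exp (-s) * resolventProd Λ (w * s)) * h3
  have hlim := tendsto_zero_of_hasDerivAt_of_integrableOn_Ioi
    (fun s hs => hderiv s (Set.mem_Ici_of_Ioi hs)) ((hI1.add hI3).sub hI2) hI2
  have h := integral_Ioi_of_hasDerivAt_of_tendsto' hderiv ((hI1.add hI3).sub hI2) hlim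
  have hsub := integral_sub (hI1.add hI3) hI2
  simp only [Pi.add_apply] at hsub
  rw [hsub, integral_add hI1 hI3, integral_const_mul,
    zero_pow hn.ne'] at h
  simp only [tailMoment]
  linarith

lemma tailMoment_eq_zero (n : ℕ) (Λ : Fin p → ℝ) (w : ℝ) {a : ℕ} (ha : p ≤ a) :
    tailMoment n Λ w a = 0 := by
  simp [tailMoment, esymmTail_eq_zero Λ ha]

end IntegrationByParts

section ResolventMoment

variable {p n : ℕ} {Λ : Fin p → ℝ}

lemma minorKernel_eq (Λ : Fin p → ℝ) (w : ℝ) (I : Finset (Fin p)) (s : ℝ) :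
    minorKernel n Λ w I s = ((n - 1).factorial : ℝ)⁻¹ *
        (s ^ (n - 1) * Real.exp (-s) * resolventProd Λ (w * s))
      - ((n - 1).factorial : ℝ)⁻¹ * w / n * (s ^ (n - 1) * s * Real.exp (-s) *
        (resolventProd Λ (w * s) * ∑ j ∈ I, Λ j / (1 + w * s * Λ j))) := by
  rw [minorKernel, resolventProd]
  ring

lemma integrableOn_minorKernel (hΛ : ∀ j, 0 < Λ j) {w : ℝ} (hw : 0 ≤ w) (hn : 0 < n)
    (I : Finset (Fin p)) : IntegrableOn (minorKernel n Λ w I) (Set.Ioi 0) := by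
  refine (((integrableOn_resolventProd hΛ hw (n - 1)).const_mul ((n - 1).factorial : ℝ)⁻¹).sub
    ((integrableOn_resolventProd_mul_sum hΛ hw n I).const_mul
      (((n - 1).factorial : ℝ)⁻¹ * w / n))).congr (.of_forall fun s => ?_)
  simp only [Pi.sub_apply, minorKernel_eq]
  rw [← pow_succ, Nat.sub_add_cancel hn]

lemma sum_powersetCard_integral_minorKernel (hΛ : ∀ j, 0 < Λ j) {w : ℝ} (hw : 0 ≤ w)
    (hn : 0 < n) (a : ℕ) :
    ∑ I ∈ Finset.univ.powersetCard (a + 1),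
        (∏ i ∈ I, Λ i) * ∫ s in Set.Ioi (0 : ℝ), minorKernel n Λ w I s
      = (n.factorial : ℝ)⁻¹ *
        (tailMoment n Λ w a - w * (n - (a + 1)) * tailMoment n Λ w (a + 1)) := by
  rw [← integral_esymm_sub_weightedEsymm hΛ hw hn, ← integral_const_mul]
  simp_rw [← integral_const_mul]
  rw [← integral_finsetSum _ fun I _ => (integrableOn_minorKernel hΛ hw hn I).const_mul _]
  congr 1
  ext s
  have hn' : (n : ℝ) ≠ 0 := by exact_mod_cast hn.ne'
  have hf : (n.factorial : ℝ) = n * (n - 1).factorial := by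
    exact_mod_cast (Nat.mul_factorial_pred hn.ne').symm
  have hf0 : ((n - 1).factorial : ℝ) ≠ 0 := by positivity
  rw [hf, esymm, weightedEsymm, Finset.mul_sum, Finset.mul_sum, ← Finset.sum_sub_distrib,
    Finset.mul_sum, Finset.mul_sum, Finset.mul_sum]
  refine Finset.sum_congr rfl fun I _ => ?_
  rw [minorKernel_eq]
  field_simp

lemma integral_eigenvalueResolvent_eq_sum_tailMoment (hpn : p ≤ n) (hn : 0 < n)
    (hΛ : ∀ j, 0 < Λ j) {w : ℝ} (hw : 0 ≤ w) :
    ∫ W : Fin p → Fin n → ℂ, eigenvalueResolvent w W ∂(wishartMeasureComplex p n Λ)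
      = ∑ a ∈ Finset.range p, w ^ a / (n - 1 - a).factorial * tailMoment n Λ w a := by
  rw [integral_eigenvalueResolvent hΛ hw hn, ← Finset.powerset_univ, Finset.sum_powerset,
    Finset.card_fin]
  have h1 : ∀ b ∈ Finset.range (p + 1), ∑ I ∈ Finset.univ.powersetCard b,
      (I.card * w ^ (I.card - 1)) * (n.descFactorial I.card * (∏ i ∈ I, Λ i) *
        ∫ s in Set.Ioi (0 : ℝ), minorKernel n Λ w I s)
      = (b * w ^ (b - 1)) * n.descFactorial b * ∑ I ∈ Finset.univ.powersetCard b,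
        (∏ i ∈ I, Λ i) * ∫ s in Set.Ioi (0 : ℝ), minorKernel n Λ w I s := by
    intro b _
    rw [Finset.mul_sum]
    refine Finset.sum_congr rfl fun I hI => ?_
    rw [(Finset.mem_powersetCard.1 hI).2]
    ring
  rw [Finset.sum_congr rfl h1, Finset.sum_range_succ']
  simp only [Nat.cast_zero, zero_mul, add_zero, Nat.add_sub_cancel]
  set u : ℕ → ℝ := fun a => w ^ a / (n - 1 - a).factorial * tailMoment n Λ w a with hu
  have hup : u p = 0 := by simp [hu, tailMoment_eq_zero]
  have h2 : ∀ a ∈ Finset.range p, ((a + 1 : ℕ) * w ^ a) * n.descFactorial (a + 1) *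
      ∑ I ∈ Finset.univ.powersetCard (a + 1),
        (∏ i ∈ I, Λ i) * ∫ s in Set.Ioi (0 : ℝ), minorKernel n Λ w I s
      = u a - ((a + 1 : ℕ) * u (a + 1) - a * u a) := by
    intro a ha
    have han : a + 1 ≤ n := (Nat.succ_le_of_lt (Finset.mem_range.1 ha)).trans hpn
    rw [sum_powersetCard_integral_minorKernel hΛ hw hn]
    have hd : (n.descFactorial (a + 1) : ℝ) * (n.factorial : ℝ)⁻¹
        = ((n - 1 - a).factorial : ℝ)⁻¹ := by
      have := Nat.factorial_mul_descFactorial han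
      rw [show n - (a + 1) = n - 1 - a by omega] at this
      have h3 : ((n - 1 - a).factorial : ℝ) * n.descFactorial (a + 1) = n.factorial := by
        exact_mod_cast this
      have h4 : ((n - 1 - a).factorial : ℝ) ≠ 0 := by positivity
      have h5 : (n.factorial : ℝ) ≠ 0 := by positivity
      field_simp
      linarith
    have hlast : ((n - 1 - a).factorial : ℝ)⁻¹ * ((n - (a + 1)) * tailMoment n Λ w (a + 1))
        = ((n - 1 - (a + 1)).factorial : ℝ)⁻¹ * tailMoment n Λ w (a + 1) := by
      rcases Nat.eq_or_lt_of_le han with h | h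
      · rw [tailMoment_eq_zero n Λ w (by omega : p ≤ a + 1)]
        simp
      · obtain ⟨k, hk⟩ : ∃ k, n = a + 1 + (k + 1) := ⟨n - (a + 2), by omega⟩
        have e1 : n - 1 - a = k + 1 := by omega
        have e2 : n - 1 - (a + 1) = k := by omega
        have e3 : (n : ℝ) - (a + 1) = k + 1 := by
          rw [hk]
          push_cast
          ring
        have e4 : (k.factorial : ℝ) ≠ 0 := by positivity
        have e5 : (k : ℝ) + 1 ≠ 0 := by positivity
        rw [e1, e2, e3, Nat.factorial_succ]
        push_cast
        field_simp
    simp only [hu]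
    push_cast
    linear_combination ((a + 1 : ℝ) * w ^ a *
      (tailMoment n Λ w a - w * (n - (a + 1)) * tailMoment n Λ w (a + 1))) * hd
      - (a + 1 : ℝ) * w ^ (a + 1) * hlast
  rw [Finset.sum_congr rfl h2, Finset.sum_sub_distrib, Finset.sum_range_sub fun a => (a : ℝ) * u a,
    hup]
  simp

end ResolventMoment

section OnePointFunction

variable {p n : ℕ} {Λ : Fin p → ℝ}

/-- The coefficient of `x ^ (n - 1 - b) * exp (-x / Λ j)` in `p` times the one-point function. -/
noncomputable def onePointCoeff (n : ℕ) (Λ : Fin p → ℝ) (j : Fin p) (b : ℕ) : ℝ :=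
  (-1) ^ b * (esymm (Finset.univ.erase j) Λ b / ∏ l ∈ Finset.univ.erase j, (1 - Λ l / Λ j)) *
    ((Λ j) ^ n)⁻¹ / (n - 1 - b).factorial

lemma onePointFunctionComplex_eq (hp : 1 ≤ p) (x : ℝ) :
    p * onePointFunctionComplex p n Λ x = ∑ j, ∑ b ∈ Finset.range p,
      onePointCoeff n Λ j b * (x ^ (n - 1 - b) * Real.exp (-((Λ j)⁻¹ * x))) := by
  have hp' : (p : ℝ) ≠ 0 := by exact_mod_cast (by omega : p ≠ 0)
  rw [onePointFunctionComplex, mul_inv_cancel_left₀ hp']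
  refine Finset.sum_congr rfl fun j _ => ?_
  rw [Finset.mul_sum, ← Finset.Ico_add_one_right_eq_Icc, Finset.sum_Ico_eq_sum_range,
    Nat.add_sub_cancel]
  refine Finset.sum_congr rfl fun b _ => ?_
  rw [add_tsub_cancel_left, esymm_neg, onePointCoeff, ← Nat.sub_sub, div_eq_inv_mul x]
  ring

lemma integrableOn_mul_pow_mul_exp {g : ℝ → ℝ} (hg : Measurable g) {C : ℝ}
    (hC : ∀ x, 0 < x → |g x| ≤ C) (m : ℕ) {a : ℝ} (ha : 0 < a) :
    IntegrableOn (fun x => g x * (x ^ m * Real.exp (-(a * x)))) (Set.Ioi 0) :=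
  (integrableOn_pow_mul_exp_neg_mul m ha).bdd_mul (c := C) hg.aestronglyMeasurable
    ((ae_restrict_iff' measurableSet_Ioi).2 (.of_forall fun s hs => hC s hs))

lemma integral_mul_onePointFunctionComplex (hp : 1 ≤ p) (hΛ : ∀ j, 0 < Λ j) {g : ℝ → ℝ}
    (hg : Measurable g) {C : ℝ} (hC : ∀ x, 0 < x → |g x| ≤ C) :
    ∫ x in Set.Ioi (0 : ℝ), g x * (p * onePointFunctionComplex p n Λ x)
      = ∑ j, ∑ b ∈ Finset.range p, onePointCoeff n Λ j b *
        ∫ x in Set.Ioi (0 : ℝ), g x * (x ^ (n - 1 - b) * Real.exp (-((Λ j)⁻¹ * x))) := by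
  have hI := fun (j : Fin p) (b : ℕ) =>
    (integrableOn_mul_pow_mul_exp hg hC (n - 1 - b) (inv_pos.2 (hΛ j))).const_mul
      (onePointCoeff n Λ j b)
  simp_rw [onePointFunctionComplex_eq hp, ← integral_const_mul]
  rw [← Finset.sum_congr rfl fun j _ => integral_finsetSum _ fun b _ => hI j b,
    ← integral_finsetSum _ fun j _ => integrable_finsetSum _ fun b _ => hI j b]
  congr 1
  ext x
  simp only [Finset.mul_sum]
  refine Finset.sum_congr rfl fun j _ => Finset.sum_congr rfl fun b _ => ?_
  ring

lemma integrableOn_onePointFunctionComplex (hp : 1 ≤ p) (hΛ : ∀ j, 0 < Λ j) :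
    IntegrableOn (fun x => p * onePointFunctionComplex p n Λ x) (Set.Ioi 0) := by
  simp_rw [onePointFunctionComplex_eq hp]
  exact integrable_finsetSum _ fun j _ => integrable_finsetSum _ fun b _ =>
    (integrableOn_pow_mul_exp_neg_mul (n - 1 - b) (inv_pos.2 (hΛ j))).const_mul _

lemma integral_onePointFunctionComplex (hp : 1 ≤ p) (hpn : p ≤ n) (hΛ : ∀ j, 0 < Λ j)
    (hdist : Function.Injective Λ) :
    ∫ x in Set.Ioi (0 : ℝ), p * onePointFunctionComplex p n Λ x = p := by
  have h := integral_mul_onePointFunctionComplex (n := n) hp hΛ (g := fun _ => 1) (C := 1)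
    measurable_const (by simp)
  simp only [one_mul] at h
  rw [h]
  have hj : ∀ j : Fin p, ∑ b ∈ Finset.range p, onePointCoeff n Λ j b *
      ∫ x in Set.Ioi (0 : ℝ), x ^ (n - 1 - b) * Real.exp (-((Λ j)⁻¹ * x)) = 1 := by
    intro j
    have hD := prod_one_sub_div_ne_zero hΛ hdist j
    have hprod := prod_one_add_mul_eq_sum_esymm (Finset.univ.erase j) Λ (-(Λ j)⁻¹)
    rw [Finset.card_erase_of_mem (Finset.mem_univ j), Finset.card_fin, Nat.sub_add_cancel hp,
      Finset.prod_congr rfl fun l _ => (by ring : 1 + Λ l * -(Λ j)⁻¹ = 1 - Λ l / Λ j)] at hprod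
    rw [← div_self hD]
    conv_rhs => rw [hprod]
    rw [Finset.sum_div]
    refine Finset.sum_congr rfl fun b hb => ?_
    have hbn : n = n - 1 - b + 1 + b := by
      have := Finset.mem_range.1 hb
      omega
    have h0 := (hΛ j).ne'
    have hf : ((n - 1 - b).factorial : ℝ) ≠ 0 := by positivity
    rw [integral_pow_mul_exp_neg_mul _ (inv_pos.2 (hΛ j)), ← hprod, onePointCoeff]
    generalize ∏ l ∈ Finset.univ.erase j, (1 - Λ l / Λ j) = D at hD
    have hpw : (Λ j ^ n)⁻¹ = (Λ j ^ (n - 1 - b + 1))⁻¹ * (Λ j ^ b)⁻¹ := by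
      rw [← mul_inv, ← pow_add, ← hbn]
    rw [hpw, neg_pow (Λ j)⁻¹, inv_pow, inv_pow]
    field_simp
  rw [Finset.sum_congr rfl fun j _ => hj j]
  simp

lemma integral_resolvent_mul_onePointFunctionComplex (hp : 1 ≤ p) (hpn : p ≤ n)
    (hΛ : ∀ j, 0 < Λ j) (hdist : Function.Injective Λ) {w : ℝ} (hw : 0 < w) :
    ∫ x in Set.Ioi (0 : ℝ), x / (1 + w * x) * (p * onePointFunctionComplex p n Λ x)
      = ∑ a ∈ Finset.range p, w ^ a / (n - 1 - a).factorial * tailMoment n Λ w a := by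
  rw [integral_mul_onePointFunctionComplex hp hΛ (g := fun x => x / (1 + w * x)) (C := w⁻¹)
    (by fun_prop), Finset.sum_comm]
  · refine Finset.sum_congr rfl fun b hb => ?_
    have hbn : n = n - 1 - b + 1 + b := by
      have := Finset.mem_range.1 hb
      omega
    have hI : ∀ j, IntegrableOn (fun s : ℝ => s ^ (n - b) * Real.exp (-s) *
        (1 + w * s * Λ j)⁻¹) (Set.Ioi 0) := fun j =>
      integrableOn_pow_mul_exp_neg_mul_bdd _ (C := 1) (by fun_prop) fun s hs => by
        have := one_add_mul_pos hΛ (mul_nonneg hw.le hs.le) j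
        rw [abs_of_nonneg (inv_nonneg.2 (zero_le_one.trans this))]
        exact inv_le_one_of_one_le₀ this
    have hj : ∀ j, ∫ x in Set.Ioi (0 : ℝ),
        x / (1 + w * x) * (x ^ (n - 1 - b) * Real.exp (-((Λ j)⁻¹ * x)))
        = Λ j ^ (n - b + 1) * ∫ s in Set.Ioi (0 : ℝ), s ^ (n - b) * Real.exp (-s) *
          (1 + w * s * Λ j)⁻¹ := by
      intro j
      have h := integral_comp_mul_left_Ioi (fun x : ℝ => x / (1 + w * x) *
        (x ^ (n - 1 - b) * Real.exp (-((Λ j)⁻¹ * x)))) 0 (hΛ j)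
      rw [mul_zero, smul_eq_mul, eq_inv_mul_iff_mul_eq₀ (hΛ j).ne'] at h
      rw [← h, pow_succ', mul_assoc, ← integral_const_mul (Λ j ^ (n - b))]
      congr 1
      refine integral_congr_ae (.of_forall fun s => ?_)
      simp only
      rw [inv_mul_cancel_left₀ (hΛ j).ne', show n - b = n - 1 - b + 1 by omega]
      ring
    simp_rw [hj]
    rw [tailMoment, ← integral_const_mul]
    simp_rw [← integral_const_mul]
    rw [← integral_finsetSum _ fun j _ => ((hI j).const_mul _).const_mul _]
    refine setIntegral_congr_fun measurableSet_Ioi fun s hs => ?_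
    have hx : ∀ j, 1 + w * s * Λ j ≠ 0 := fun j =>
      (zero_lt_one.trans_le (one_add_mul_pos hΛ (mul_nonneg hw.le (le_of_lt hs)) j)).ne'
    have h := sum_esymm_div_eq_pow_mul_esymmTail hΛ hdist b hx
    have hsn : s ^ n = s ^ (n - b) * s ^ b := by
      rw [← pow_add]
      congr 1
      omega
    have hgoal : w ^ b / (n - 1 - b).factorial * (s ^ n * Real.exp (-s) *
        (resolventProd Λ (w * s) * esymmTail Λ b (w * s)))
        = s ^ (n - b) * Real.exp (-s) / (n - 1 - b).factorial *
          ((w * s) ^ b * ((∏ i, (1 + w * s * Λ i)⁻¹) * esymmTail Λ b (w * s))) := by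
      rw [hsn, resolventProd, mul_pow]
      ring
    rw [hgoal, ← h, Finset.mul_sum]
    refine Finset.sum_congr rfl fun j _ => ?_
    have h0 := (hΛ j).ne'
    have hpw : Λ j ^ (n - b + 1) * (Λ j ^ n)⁻¹ = Λ j * (Λ j ^ b)⁻¹ := by
      have : Λ j ^ n = Λ j ^ (n - b) * Λ j ^ b := by
        rw [← pow_add]
        congr 1
        omega
      rw [this, pow_succ]
      field_simp
    rw [onePointCoeff, neg_pow (Λ j)⁻¹, inv_pow]
    linear_combination ((-1) ^ b * (esymm (Finset.univ.erase j) Λ b /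
      ∏ l ∈ Finset.univ.erase j, (1 - Λ l / Λ j)) / (n - 1 - b).factorial *
      (s ^ (n - b) * Real.exp (-s) * (1 + w * s * Λ j)⁻¹)) * hpw
  · intro x hx
    have hx1 : 0 < 1 + w * x := by positivity
    rw [abs_of_nonneg (div_nonneg hx.le hx1.le), div_le_iff₀ hx1, mul_add, mul_one,
      inv_mul_cancel_left₀ hw.ne']
    exact le_add_of_nonneg_left (inv_nonneg.2 hw.le)

lemma integral_eigenvalueResolvent_eq (hp : 1 ≤ p) (hpn : p ≤ n) (hΛ : ∀ j, 0 < Λ j)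
    (hdist : Function.Injective Λ) {w : ℝ} (hw : 0 < w) :
    ∫ W : Fin p → Fin n → ℂ, eigenvalueResolvent w W ∂(wishartMeasureComplex p n Λ)
      = ∫ x in Set.Ioi (0 : ℝ), x / (1 + w * x) * (p * onePointFunctionComplex p n Λ x) := by
  rw [integral_eigenvalueResolvent_eq_sum_tailMoment hpn (by omega) hΛ hw.le,
    integral_resolvent_mul_onePointFunctionComplex hp hpn hΛ hdist hw]

end OnePointFunction

section LinearStatisticDensity

/-- The function `φ` on the positive half line is the density of the point process
`lam W 1, …, lam W p` as far as the test function `g` can see. -/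
structure HasStatisticDensity {Ω ι : Type*} [MeasurableSpace Ω] [Fintype ι] (μ : Measure Ω)
    (lam : Ω → ι → ℝ) (φ g : ℝ → ℝ) : Prop where
  integrable : Integrable (fun W => ∑ j, g (lam W j)) μ
  integrableOn : IntegrableOn (fun x => g x * φ x) (Set.Ioi 0)
  integral_eq : ∫ W, ∑ j, g (lam W j) ∂μ = ∫ x in Set.Ioi (0 : ℝ), g x * φ x

namespace HasStatisticDensity

variable {Ω ι : Type*} [MeasurableSpace Ω] [Fintype ι] {μ : Measure Ω} {lam : Ω → ι → ℝ}
  {φ g h : ℝ → ℝ}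

lemma const_mul (hg : HasStatisticDensity μ lam φ g) (c : ℝ) :
    HasStatisticDensity μ lam φ fun x => c * g x where
  integrable := by simpa only [Finset.mul_sum] using hg.integrable.const_mul c
  integrableOn := by simpa only [IntegrableOn, mul_assoc] using hg.integrableOn.const_mul c
  integral_eq := by
    simp_rw [← Finset.mul_sum, mul_assoc]
    rw [integral_const_mul, integral_const_mul, hg.integral_eq]

lemma add (hg : HasStatisticDensity μ lam φ g) (hh : HasStatisticDensity μ lam φ h) :
    HasStatisticDensity μ lam φ fun x => g x + h x where
  integrable := (hg.integrable.add hh.integrable).congr <| .of_forall fun W =>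
    Finset.sum_add_distrib.symm
  integrableOn := (hg.integrableOn.add hh.integrableOn).congr <| .of_forall fun x =>
    (add_mul (g x) (h x) (φ x)).symm
  integral_eq := by
    simp_rw [Finset.sum_add_distrib, add_mul]
    rw [integral_add hg.integrable hh.integrable, integral_add hg.integrableOn hh.integrableOn,
      hg.integral_eq, hh.integral_eq]

lemma congr_nonneg (hg : HasStatisticDensity μ lam φ g) (hlam : ∀ W j, 0 ≤ lam W j)
    (hgh : ∀ x, 0 ≤ x → g x = h x) : HasStatisticDensity μ lam φ h where
  integrable := hg.integrable.congr <| .of_forall fun W =>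
    Finset.sum_congr rfl fun j _ => hgh _ (hlam W j)
  integrableOn := hg.integrableOn.congr_fun
    (fun x hx => congrArg (· * φ x) (hgh x (le_of_lt hx))) measurableSet_Ioi
  integral_eq := by
    rw [← setIntegral_congr_fun measurableSet_Ioi fun x hx =>
      congrArg (· * φ x) (hgh x (le_of_lt hx)), ← hg.integral_eq]
    exact integral_congr_ae <| .of_forall fun W =>
      Finset.sum_congr rfl fun j _ => (hgh _ (hlam W j)).symm

lemma of_tendsto [IsFiniteMeasure μ] (hlam : ∀ W j, 0 ≤ lam W j)
    (hφ : IntegrableOn φ (Set.Ioi 0)) {gs : ℕ → ℝ → ℝ} {C : ℝ}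
    (hgs : ∀ m, HasStatisticDensity μ lam φ (gs m)) (hC : ∀ m x, 0 ≤ x → |gs m x| ≤ C)
    (hlim : ∀ x, 0 ≤ x → Filter.Tendsto (fun m => gs m x) Filter.atTop (nhds (g x))) :
    HasStatisticDensity μ lam φ g := by
  have hb1 : ∀ m, ∀ᵐ W ∂μ, ‖∑ j, gs m (lam W j)‖ ≤ Fintype.card ι * C := fun m =>
    .of_forall fun W => by
      refine (norm_sum_le _ _).trans ((Finset.sum_le_card_nsmul _ _ C fun j _ =>
        hC m _ (hlam W j)).trans ?_)
      simp
  have hl1 : ∀ᵐ W ∂μ, Filter.Tendsto (fun m => ∑ j, gs m (lam W j)) Filter.atTop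
      (nhds (∑ j, g (lam W j))) :=
    .of_forall fun W => tendsto_finsetSum _ fun j _ => hlim _ (hlam W j)
  have hb2 : ∀ m, ∀ᵐ x ∂(volume.restrict (Set.Ioi (0 : ℝ))), ‖gs m x * φ x‖ ≤ C * ‖φ x‖ :=
    fun m => (ae_restrict_iff' measurableSet_Ioi).2 <| .of_forall fun x hx => by
      rw [norm_mul]
      exact mul_le_mul_of_nonneg_right (hC m x (le_of_lt hx)) (norm_nonneg _)
  have hl2 : ∀ᵐ x ∂(volume.restrict (Set.Ioi (0 : ℝ))),
      Filter.Tendsto (fun m => gs m x * φ x) Filter.atTop (nhds (g x * φ x)) :=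
    (ae_restrict_iff' measurableSet_Ioi).2 <| .of_forall fun x hx =>
      (hlim x (le_of_lt hx)).mul_const _
  have hi2 : Integrable (fun x => C * ‖φ x‖) (volume.restrict (Set.Ioi (0 : ℝ))) :=
    hφ.norm.const_mul C
  have hm1 := aestronglyMeasurable_of_tendsto_ae Filter.atTop
    (fun m => (hgs m).integrable.aestronglyMeasurable) hl1
  have hm2 := aestronglyMeasurable_of_tendsto_ae Filter.atTop
    (fun m => (hgs m).integrableOn.aestronglyMeasurable) hl2
  refine ⟨?_, ?_, ?_⟩
  · refine (integrable_const (Fintype.card ι * C)).mono' hm1 ?_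
    filter_upwards [hl1, ae_all_iff.2 hb1] with W h1 h2
    exact le_of_tendsto h1.norm (.of_forall h2)
  · refine hi2.mono' hm2 ?_
    filter_upwards [hl2, ae_all_iff.2 hb2] with x h1 h2
    exact le_of_tendsto h1.norm (.of_forall h2)
  · have h1 := tendsto_integral_of_dominated_convergence _
      (fun m => (hgs m).integrable.aestronglyMeasurable) (integrable_const _) hb1 hl1
    have h2 := tendsto_integral_of_dominated_convergence _
      (fun m => (hgs m).integrableOn.aestronglyMeasurable) hi2 hb2 hl2
    simp_rw [(hgs _).integral_eq] at h1
    exact tendsto_nhds_unique h1 h2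

lemma pow_div_one_add [IsFiniteMeasure μ] (hlam : ∀ W j, 0 ≤ lam W j)
    (hφ : IntegrableOn φ (Set.Ioi 0))
    (hres : ∀ w, 0 < w → HasStatisticDensity μ lam φ fun x => x / (1 + w * x)) (k : ℕ) :
    HasStatisticDensity μ lam φ fun x => (x / (1 + x)) ^ (k + 1) := by
  have hy : ∀ x : ℝ, 0 ≤ x → 0 ≤ x / (1 + x) ∧ x / (1 + x) ≤ 1 := fun x hx =>
    ⟨by positivity, by rw [div_le_one (by linarith)]; linarith⟩
  have hlimit : ∀ k, (∀ t : ℝ, 0 < t → HasStatisticDensity μ lam φ fun x =>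
      (x / (1 + x)) ^ (k + 1) / (1 + t * (x / (1 + x)))) →
      HasStatisticDensity μ lam φ fun x => (x / (1 + x)) ^ (k + 1) := by
    intro k hk
    refine of_tendsto (C := 1) hlam hφ (fun m : ℕ => hk (1 / ((m : ℝ) + 1)) (by positivity)) ?_ ?_
    · intro m x hx
      obtain ⟨h0, h1⟩ := hy x hx
      have h2 : 0 ≤ 1 / ((m : ℝ) + 1) * (x / (1 + x)) := by positivity
      rw [abs_of_nonneg (by positivity)]
      exact (div_le_self (by positivity) (by linarith)).trans (pow_le_one₀ h0 h1)
    · intro x hx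
      have h := ((tendsto_one_div_add_atTop_nhds_zero_nat (𝕜 := ℝ)).mul_const
        (x / (1 + x))).const_add 1
      have h2 := (tendsto_const_nhds (x := (x / (1 + x)) ^ (k + 1))).div h (by simp)
      rw [zero_mul, add_zero, div_one] at h2
      exact h2
  refine hlimit k ?_
  induction k with
  | zero =>
    intro t ht
    refine (hres (1 + t) (by linarith)).congr_nonneg hlam fun x hx => ?_
    have h1 : 1 + x ≠ 0 := by positivity
    have h2 : 1 + (1 + t) * x ≠ 0 := by positivity
    have h3 : 1 + t * (x / (1 + x)) ≠ 0 := by positivity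
    rw [zero_add, pow_one, div_eq_div_iff h2 h3]
    field_simp
    ring
  | succ k ih =>
    intro t ht
    refine (((hlimit k ih).add ((ih t ht).const_mul (-1))).const_mul t⁻¹).congr_nonneg hlam
      fun x hx => ?_
    have h3 : 1 + t * (x / (1 + x)) ≠ 0 := by positivity
    generalize x / (1 + x) = y at h3
    field_simp
    ring

lemma polynomial_div_one_add [IsFiniteMeasure μ] (hlam : ∀ W j, 0 ≤ lam W j)
    (hφ : IntegrableOn φ (Set.Ioi 0)) (hone : HasStatisticDensity μ lam φ fun _ => 1)
    (hres : ∀ w, 0 < w → HasStatisticDensity μ lam φ fun x => x / (1 + w * x))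
    (q : Polynomial ℝ) : HasStatisticDensity μ lam φ fun x => q.eval (x / (1 + x)) := by
  induction q using Polynomial.induction_on' with
  | add q r hq hr => simpa only [Polynomial.eval_add] using hq.add hr
  | monomial k c =>
    simp only [Polynomial.eval_monomial]
    cases k with
    | zero => simpa only [pow_zero] using hone.const_mul c
    | succ k => exact (pow_div_one_add hlam hφ hres k).const_mul c

lemma of_continuous_bounded [IsFiniteMeasure μ] (hlam : ∀ W j, 0 ≤ lam W j)
    (hφ : IntegrableOn φ (Set.Ioi 0)) (hone : HasStatisticDensity μ lam φ fun _ => 1)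
    (hres : ∀ w, 0 < w → HasStatisticDensity μ lam φ fun x => x / (1 + w * x))
    (hg : Continuous g) {C : ℝ} (hC : ∀ x, |g x| ≤ C) : HasStatisticDensity μ lam φ g := by
  have hpos : ∀ m : ℕ, 0 < 1 / ((m : ℝ) + 1) := fun m => by positivity
  have hcont : ∀ m : ℕ, Continuous fun y : ℝ => g (y / max (1 - y) (1 / ((m : ℝ) + 1))) :=
    fun m => hg.comp (continuous_id.div (by fun_prop) fun y =>
      (lt_max_of_lt_right (hpos m)).ne')
  choose q hq using fun m : ℕ => exists_polynomial_near_of_continuousOn 0 1 _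
    (hcont m).continuousOn _ (hpos m)
  have hy : ∀ x : ℝ, 0 ≤ x → x / (1 + x) ∈ Set.Icc (0 : ℝ) 1 := fun x hx =>
    ⟨by positivity, by rw [div_le_one (by linarith)]; linarith⟩
  have hle : ∀ m : ℕ, 1 / ((m : ℝ) + 1) ≤ 1 := fun m => by
    rw [div_le_one (by positivity)]
    linarith [(Nat.cast_nonneg m : (0 : ℝ) ≤ m)]
  refine of_tendsto (C := C + 1) hlam hφ
    (fun m => polynomial_div_one_add hlam hφ hone hres (q m)) ?_ ?_
  · intro m x hx
    have h1 := hq m _ (hy x hx)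
    have h2 := hC (x / (1 + x) / max (1 - x / (1 + x)) (1 / ((m : ℝ) + 1)))
    have h3 := hle m
    rw [abs_lt] at h1
    rw [abs_le] at h2 ⊢
    constructor <;> linarith
  · intro x hx
    rw [tendsto_iff_dist_tendsto_zero]
    refine squeeze_zero' (.of_forall fun _ => dist_nonneg) ?_
      (tendsto_one_div_add_atTop_nhds_zero_nat (𝕜 := ℝ))
    filter_upwards [Filter.eventually_ge_atTop ⌈x⌉₊] with m hm
    have hxm : x ≤ m := (Nat.le_ceil x).trans (by exact_mod_cast hm)
    have h1 := hq m _ (hy x hx)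
    have h2 : 1 - x / (1 + x) = 1 / (1 + x) := by
      field_simp
      ring
    rw [h2, max_eq_left (one_div_le_one_div_of_le (by linarith) (by linarith))] at h1
    have h3 : x / (1 + x) / (1 / (1 + x)) = x := by
      field_simp
    rw [h3] at h1
    exact h1.le

end HasStatisticDensity

end LinearStatisticDensity

section WishartStatistic

open scoped ComplexConjugate ComplexOrder

lemma hasStatisticDensity_wishart {p n : ℕ} (hp : 1 ≤ p) (hpn : p ≤ n) {Λ : Fin p → ℝ}
    (hΛ : ∀ j, 0 < Λ j) (hdist : Function.Injective Λ) {g : ℝ → ℝ} (hg : Continuous g) {C : ℝ}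
    (hC : ∀ x, |g x| ≤ C) :
    HasStatisticDensity (wishartMeasureComplex p n Λ)
      (fun W j => (isHermitian_mul_conjTranspose_self (of W)).eigenvalues j)
      (fun x => p * onePointFunctionComplex p n Λ x) g := by
  have hprob := isProbabilityMeasure_wishartMeasureComplex (n := n) hΛ (by omega)
  have hφ := integrableOn_onePointFunctionComplex (n := n) hp hΛ
  refine HasStatisticDensity.of_continuous_bounded
    (fun W j => (posSemidef_self_mul_conjTranspose (of W)).eigenvalues_nonneg j) hφ
    ⟨integrable_const _, by simpa only [one_mul] using hφ, ?_⟩ (fun w hw => ?_) hg hC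
  · simp only [one_mul]
    rw [integral_onePointFunctionComplex hp hpn hΛ hdist]
    simp
  · have heq := integral_eigenvalueResolvent_eq hp hpn hΛ hdist hw
    refine ⟨integrable_eigenvalueResolvent hΛ hw.le, ?_, heq⟩
    refine hφ.bdd_mul (c := w⁻¹)
      (by fun_prop : Measurable fun x : ℝ => x / (1 + w * x)).aestronglyMeasurable ?_
    refine (ae_restrict_iff' measurableSet_Ioi).2 (.of_forall fun x hx => ?_)
    have hx : 0 < x := hx
    have hx1 : 0 < 1 + w * x := by positivity
    rw [Real.norm_of_nonneg (by positivity), div_le_iff₀ hx1, mul_add, mul_one,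
      inv_mul_cancel_left₀ hw.ne']
    exact le_add_of_nonneg_left (inv_nonneg.2 hw.le)

lemma HasStatisticDensity.integral_complex {Ω ι : Type*} [MeasurableSpace Ω] [Fintype ι]
    {μ : Measure Ω} {lam : Ω → ι → ℝ} {φ : ℝ → ℝ} {f : ℝ → ℂ}
    (hre : HasStatisticDensity μ lam φ fun x => (f x).re)
    (him : HasStatisticDensity μ lam φ fun x => (f x).im) :
    ∫ W, ∑ j, f (lam W j) ∂μ = ∫ x in Set.Ioi (0 : ℝ), f x * (φ x : ℂ) := by
  have h1 : ∀ W, ∑ j, f (lam W j) = ((∑ j, (f (lam W j)).re : ℝ) : ℂ)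
      + ((∑ j, (f (lam W j)).im : ℝ) : ℂ) * Complex.I := fun W => by
    push_cast
    rw [Finset.sum_mul, ← Finset.sum_add_distrib]
    exact Finset.sum_congr rfl fun j _ => (Complex.re_add_im _).symm
  have h2 : ∀ x, f x * (φ x : ℂ) = (((f x).re * φ x : ℝ) : ℂ)
      + (((f x).im * φ x : ℝ) : ℂ) * Complex.I := fun x => by
    conv_lhs => rw [← Complex.re_add_im (f x)]
    push_cast
    ring
  simp_rw [h1, h2]
  rw [integral_add hre.integrable.ofReal (him.integrable.ofReal.mul_const _),
    integral_add hre.integrableOn.ofReal (him.integrableOn.ofReal.mul_const _),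
    integral_mul_const, integral_mul_const, integral_complex_ofReal, integral_complex_ofReal,
    integral_complex_ofReal, integral_complex_ofReal, hre.integral_eq, him.integral_eq]

end WishartStatistic

/-- For `1 ≤ p ≤ n` and pairwise distinct positive `Λ₁,…,Λ_p`, and every bounded
continuous `f : ℝ → ℂ`, the average over the complex Wishart ensemble of
`(1/p) Σ_j f(λ_j(W))`, with `λ_j(W)` the eigenvalues of the Hermitian positive
semidefinite matrix `WW†`, equals `∫₀^∞ f(x) S₂(x) dx`: the function `S₂` is the
marginal eigenvalue density of the complex Wishart correlation matrix. -/
theorem one_point_function_complex_wishart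
    (p n : ℕ) (hp : 1 ≤ p) (hpn : p ≤ n)
    (Λ : Fin p → ℝ) (hΛ : ∀ j, 0 < Λ j) (hdist : Function.Injective Λ)
    (f : ℝ →ᵇ ℂ) :
    (∫ W, (p : ℂ)⁻¹ *
          ∑ j, f ((Matrix.isHermitian_mul_conjTranspose_self (Matrix.of W)).eigenvalues j)
        ∂(wishartMeasureComplex p n Λ))
      = ∫ x in Set.Ioi (0 : ℝ), f x * (onePointFunctionComplex p n Λ x : ℂ) := by
  have h := HasStatisticDensity.integral_complex (f := f)
    (hasStatisticDensity_wishart hp hpn hΛ hdist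
      (Complex.continuous_re.comp f.continuous) (C := ‖f‖)
      fun x => (Complex.abs_re_le_norm _).trans (f.norm_coe_le_norm x))
    (hasStatisticDensity_wishart hp hpn hΛ hdist
      (Complex.continuous_im.comp f.continuous) (C := ‖f‖)
      fun x => (Complex.abs_im_le_norm _).trans (f.norm_coe_le_norm x))
  have hp0 : (p : ℂ) ≠ 0 := by exact_mod_cast (by omega : p ≠ 0)
  rw [integral_const_mul, h, ← integral_const_mul]
  congr 1
  ext x
  push_cast
  field_simp
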